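/- Converse direction of the Ebenfelt–Khavinson–Shapiro theorem. Let n ≥ 1, let a_1, …, a_n ∈ 𝔻 and λ ∈ ℂ with |λ| = 1, and let B(z) = λ·∏_{k=1}^n (z − a_k)/(1 − conj(a_k)·z) be the corresponding finite Blaschke product of degree n. Then there exist a polynomial P ∈ ℂ[X] of degree n with positive real leading coefficient and a conformal parametrization pair (φ₋, φ₊) for Γ := {z ∈ ℂ : |P(z)| = 1} such that P'(z) ≠ 0 for every z ∈ Γ and such that wⁿ = B(z) for all z, w ∈ ℂ with |z| = |w| = 1 and φ₊(w) = φ₋(z); that is, the lemniscate L_P(1) is an analytic connected Jordan curve whose fingerprint k satisfies k(z)ⁿ = B(z). -/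

import Mathlib

open Complex Metric Set Polynomial

/-- A conformal parametrization pair for a Jordan curve `Γ ⊂ ℂ`. -/
structure ConformalPair (Γ : Set ℂ) (φm φp : ℂ → ℂ) : Prop where
  contm : ContinuousOn φm (closedBall 0 1)
  injm : InjOn φm (closedBall 0 1)
  holm : DifferentiableOn ℂ φm (ball 0 1)
  mapm : φm '' (sphere 0 1) = Γ
  contp : ContinuousOn φp {w : ℂ | 1 ≤ ‖w‖}
  injp : InjOn φp {w : ℂ | 1 ≤ ‖w‖}
  holp : DifferentiableOn ℂ φp {w : ℂ | 1 < ‖w‖}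
  mapp : φp '' (sphere 0 1) = Γ
  deriv_infty : ∃ d : ℝ, 0 < d ∧
    Filter.Tendsto (fun w => φp w / w) (Bornology.cobounded ℂ) (nhds (d : ℂ))
  disj_mp : Disjoint (φm '' ball 0 1) (φp '' {w : ℂ | 1 < ‖w‖})
  disj_mG : Disjoint (φm '' ball 0 1) Γ
  disj_pG : Disjoint (φp '' {w : ℂ | 1 < ‖w‖}) Γ
  union_eq : φm '' ball 0 1 ∪ Γ ∪ φp '' {w : ℂ | 1 < ‖w‖} = univ

section CircleIntegrals

/-- Moments of a continuous function against powers of `q` decay geometrically. -/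
lemma exists_norm_circleIntegral_mul_pow_le {f q : ℂ → ℂ} {ρ s : ℝ} (hρ : 0 ≤ ρ)
    (hf : ContinuousOn f (sphere 0 ρ)) (hq : ∀ ζ ∈ sphere (0 : ℂ) ρ, ‖q ζ‖ ≤ s) :
    ∃ C : ℝ, 0 ≤ C ∧ ∀ m : ℕ, ‖∮ ζ in C(0, ρ), f ζ * q ζ ^ m‖ ≤ C * s ^ m := by
  obtain ⟨M, hM⟩ := (isCompact_sphere (0 : ℂ) ρ).exists_bound_of_continuousOn hf
  refine ⟨2 * Real.pi * ρ * |M|, by positivity, fun m => ?_⟩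
  refine (circleIntegral.norm_integral_le_of_norm_le_const hρ
    (C := |M| * s ^ m) fun ζ hζ => ?_).trans_eq (by ring)
  rw [norm_mul, norm_pow]
  have := hq ζ hζ
  gcongr
  exact (hM ζ hζ).trans (le_abs_self M)

lemma hasSum_circleIntegral_of_norm_le {F : ℕ → ℂ → ℂ} {u : ℕ → ℝ} {ρ : ℝ} (hρ : 0 ≤ ρ)
    (hF : ∀ m, ContinuousOn (F m) (sphere 0 ρ)) (hu : Summable u)
    (hFu : ∀ m, ∀ ζ ∈ sphere (0 : ℂ) ρ, ‖F m ζ‖ ≤ u m) :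
    HasSum (fun m => ∮ ζ in C(0, ρ), F m ζ) (∮ ζ in C(0, ρ), ∑' m, F m ζ) := by
  have hmem : ∀ θ : ℝ, circleMap 0 ρ θ ∈ sphere (0 : ℂ) ρ := fun θ =>
    circleMap_mem_sphere 0 hρ θ
  refine intervalIntegral.hasSum_integral_of_dominated_convergence
    (bound := fun m _ => ρ * u m) (fun m => ?_) (fun m => ?_) ?_ ?_ ?_
  · have h1 : Continuous fun θ : ℝ => F m (circleMap 0 ρ θ) :=
      (hF m).comp_continuous (continuous_circleMap 0 ρ) hmem
    have h2 : Continuous (deriv (circleMap 0 ρ)) := by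
      have : deriv (circleMap 0 ρ) = fun θ => circleMap 0 ρ θ * I := by
        ext θ; simp
      rw [this]
      exact (continuous_circleMap 0 ρ).mul continuous_const
    exact (h2.smul h1).aestronglyMeasurable
  · refine .of_forall fun θ _ => ?_
    have := hFu m _ (hmem θ)
    rw [norm_smul, deriv_circleMap, norm_mul, norm_I, mul_one, norm_circleMap_zero,
      abs_of_nonneg hρ]
    gcongr
  · exact .of_forall fun θ _ => hu.mul_left _
  · exact intervalIntegrable_const
  · refine .of_forall fun θ _ => HasSum.const_smul _ ?_
    exact (Summable.of_norm_bounded hu fun m => hFu m _ (hmem θ)).hasSum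

lemma hasSum_circleIntegral_geometric {f q : ℂ → ℂ} {ρ s : ℝ} (hρ : 0 ≤ ρ)
    (hf : ContinuousOn f (sphere 0 ρ)) (hqc : ContinuousOn q (sphere 0 ρ))
    (hq : ∀ ζ ∈ sphere (0 : ℂ) ρ, ‖q ζ‖ ≤ s) {x : ℂ} (hx : ‖x‖ * s < 1) :
    HasSum (fun m : ℕ => x ^ m * ∮ ζ in C(0, ρ), f ζ * q ζ ^ m)
      (∮ ζ in C(0, ρ), f ζ / (1 - x * q ζ)) := by
  have hs : 0 ≤ s := (norm_nonneg _).trans (hq _ (circleMap_mem_sphere 0 hρ 0))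
  obtain ⟨M, hM⟩ := (isCompact_sphere (0 : ℂ) ρ).exists_bound_of_continuousOn hf
  have key := hasSum_circleIntegral_of_norm_le (F := fun m ζ => x ^ m * (f ζ * q ζ ^ m))
    (u := fun m => |M| * (‖x‖ * s) ^ m) hρ
    (fun m => continuousOn_const.mul (hf.mul (hqc.pow m)))
    ((summable_geometric_of_lt_one (by positivity) hx).mul_left _) fun m ζ hζ => ?_
  · have h : (∮ ζ in C(0, ρ), f ζ / (1 - x * q ζ)) =
        ∮ ζ in C(0, ρ), ∑' m, x ^ m * (f ζ * q ζ ^ m) := by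
      refine circleIntegral.integral_congr hρ fun ζ hζ => ?_
      have : ‖x * q ζ‖ < 1 := by
        rw [norm_mul]
        exact (mul_le_mul_of_nonneg_left (hq _ hζ) (norm_nonneg _)).trans_lt hx
      rw [div_eq_mul_inv, ← tsum_geometric_of_norm_lt_one this, ← tsum_mul_left]
      refine tsum_congr fun m => ?_
      rw [mul_pow]; ring
    rw [h]
    refine key.congr_fun fun m => ?_
    rw [← circleIntegral.integral_const_mul]
  · have h1 : ‖f ζ‖ ≤ |M| := (hM ζ hζ).trans (le_abs_self M)
    have h2 := hq ζ hζ
    rw [norm_mul, norm_mul, norm_pow, norm_pow, mul_pow]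
    calc _ ≤ ‖x‖ ^ m * (|M| * s ^ m) := by gcongr
      _ = _ := by ring

lemma analyticAt_tsum_mul_pow {a : ℕ → ℂ} {C s : ℝ} (hs : 0 ≤ s)
    (ha : ∀ m, ‖a m‖ ≤ C * s ^ m) {x : ℂ} (hx : ‖x‖ * s < 1) :
    AnalyticAt ℂ (fun y => ∑' m, a m * y ^ m) x := by
  obtain ⟨t, ht1, ht2⟩ : ∃ t, ‖x‖ < t ∧ t * s < 1 := by
    have : Filter.Tendsto (fun t : ℝ => t * s) (nhdsWithin ‖x‖ (Ioi ‖x‖)) (nhds (‖x‖ * s)) :=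
      (continuous_mul_const s).continuousAt.mono_left nhdsWithin_le_nhds
    obtain ⟨t, h1, h2⟩ :=
      ((this.eventually (gt_mem_nhds hx)).and self_mem_nhdsWithin).exists
    exact ⟨t, h2, h1⟩
  have ht : 0 ≤ t := (norm_nonneg x).trans ht1.le
  have hd : DifferentiableOn ℂ (fun y => ∑' m, a m * y ^ m) (ball 0 t) := by
    refine differentiableOn_tsum_of_summable_norm
      ((summable_geometric_of_lt_one (by positivity) ht2).mul_left C)
      (fun m => by fun_prop) isOpen_ball fun m y hy => ?_
    have hy' : ‖y‖ ≤ t := (mem_ball_zero_iff.mp hy).le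
    rw [norm_mul, norm_pow, mul_pow, mul_comm (t ^ m), ← mul_assoc]
    have := ha m
    have hC : 0 ≤ C * s ^ m := (norm_nonneg _).trans this
    gcongr
  exact hd.analyticAt (isOpen_ball.mem_nhds (by simpa using ht1))

lemma analyticAt_circleIntegral_div {f q : ℂ → ℂ} {ρ s : ℝ} (hρ : 0 ≤ ρ)
    (hf : ContinuousOn f (sphere 0 ρ)) (hqc : ContinuousOn q (sphere 0 ρ))
    (hq : ∀ ζ ∈ sphere (0 : ℂ) ρ, ‖q ζ‖ ≤ s) {x : ℂ} (hx : ‖x‖ * s < 1) :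
    AnalyticAt ℂ (fun y => ∮ ζ in C(0, ρ), f ζ / (1 - y * q ζ)) x := by
  have hs : 0 ≤ s := (norm_nonneg _).trans (hq _ (circleMap_mem_sphere 0 hρ 0))
  obtain ⟨C, -, hC⟩ := exists_norm_circleIntegral_mul_pow_le hρ hf hq
  refine (analyticAt_tsum_mul_pow hs hC hx).congr ?_
  have : ∀ᶠ y : ℂ in nhds x, ‖y‖ * s < 1 :=
    (show Continuous fun y : ℂ => ‖y‖ * s by fun_prop).continuousAt.eventually (gt_mem_nhds hx)
  filter_upwards [this] with y hy
  rw [← (hasSum_circleIntegral_geometric hρ hf hqc hq hy).tsum_eq]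
  simp_rw [mul_comm]

lemma circleIntegral_eq_of_annulus {f : ℂ → ℂ} {r R : ℝ} (hr : 0 < r) (hrR : r ≤ R)
    (hf : ∀ z, r ≤ ‖z‖ → ‖z‖ ≤ R → DifferentiableAt ℂ f z) :
    (∮ z in C(0, R), f z) = ∮ z in C(0, r), f z := by
  refine circleIntegral_eq_of_differentiable_on_annulus_off_countable hr hrR countable_empty
    (fun z hz => ?_) (fun z hz => ?_)
  · have h1 : ‖z‖ ≤ R := by simpa using hz.1
    have h2 : r ≤ ‖z‖ := by simpa using hz.2
    exact (hf z h2 h1).continuousAt.continuousWithinAt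
  · have h1 : ‖z‖ < R := by simpa using hz.1.1
    have h2 : r < ‖z‖ := by simpa using hz.1.2
    exact hf z h2.le h1.le

/-- Cauchy's integral formula on an annulus. -/
lemma two_pi_I_mul_eq_circleIntegral_sub {f : ℂ → ℂ} {r R : ℝ} (hr : 0 < r)
    (hf : ∀ z, r ≤ ‖z‖ → ‖z‖ ≤ R → AnalyticAt ℂ f z) {z : ℂ} (hz1 : r < ‖z‖) (hz2 : ‖z‖ < R) :
    2 * Real.pi * I * f z =
      (∮ ζ in C(0, R), f ζ / (ζ - z)) - ∮ ζ in C(0, r), f ζ / (ζ - z) := by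
  have hR : 0 < R := hr.trans (hz1.trans hz2)
  have key : (∮ ζ in C(0, R), dslope f z ζ) = ∮ ζ in C(0, r), dslope f z ζ := by
    refine circleIntegral_eq_of_annulus hr (hz1.trans hz2).le fun ζ h1 h2 => ?_
    rcases eq_or_ne ζ z with rfl | hne
    · obtain ⟨p, hp⟩ := hf ζ h1 h2
      exact hp.has_fpower_series_dslope_fslope.analyticAt.differentiableAt
    · rw [differentiableAt_dslope_of_ne hne]
      exact (hf ζ h1 h2).differentiableAt
  have split : ∀ ρ, 0 ≤ ρ → r ≤ ρ → ρ ≤ R → ρ ≠ ‖z‖ → (∮ ζ in C(0, ρ), dslope f z ζ) =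
      (∮ ζ in C(0, ρ), f ζ / (ζ - z)) - f z * ∮ ζ in C(0, ρ), (ζ - z)⁻¹ := by
    intro ρ h0 h1 h2 hne
    have hsub : ∀ ζ ∈ sphere (0 : ℂ) ρ, ζ - z ≠ 0 := by
      intro ζ hζ h
      apply hne
      rw [← sub_eq_zero.mp h]
      simpa using hζ.symm
    have hinv : ContinuousOn (fun ζ : ℂ => (ζ - z)⁻¹) (sphere 0 ρ) :=
      ContinuousOn.inv₀ (by fun_prop) hsub
    have hfc : ContinuousOn f (sphere 0 ρ) := fun ζ hζ => by
      have : ‖ζ‖ = ρ := by simpa using hζ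
      exact (hf ζ (by linarith) (by linarith)).continuousAt.continuousWithinAt
    rw [← circleIntegral.integral_const_mul, ← circleIntegral.integral_sub]
    · refine circleIntegral.integral_congr h0 fun ζ hζ => ?_
      have h := hsub ζ hζ
      rw [dslope_of_ne _ (sub_ne_zero.mp h), slope_def_field]
      field_simp
    · simp_rw [div_eq_mul_inv]
      exact (hfc.mul hinv).circleIntegrable h0
    · exact (continuousOn_const.mul hinv).circleIntegrable h0
  rw [split R hR.le (hz1.trans hz2).le le_rfl hz2.ne', split r hr.le le_rfl (hz1.trans hz2).le
    hz1.ne, circleIntegral.integral_sub_inv_of_mem_ball (by simpa using hz2)] at key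
  have h0 : (∮ ζ in C(0, r), (ζ - z)⁻¹) = 0 := by
    refine circleIntegral_eq_zero_of_differentiable_on_off_countable hr.le countable_empty
      (fun ζ hζ => ?_) fun ζ hζ => ?_
    · have h1 : ‖ζ‖ ≤ r := by simpa using hζ
      have : ζ - z ≠ 0 := fun h => by rw [sub_eq_zero.mp h] at h1; linarith
      exact ((continuousAt_id.sub continuousAt_const).inv₀ this).continuousWithinAt
    · have h1 : ‖ζ‖ < r := by simpa using hζ.1
      have : ζ - z ≠ 0 := fun h => by rw [sub_eq_zero.mp h] at h1; linarith
      exact DifferentiableAt.inv (by fun_prop) this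
  rw [h0] at key
  linear_combination -key

end CircleIntegrals

/-- A function on the compact Riemann surface obtained by welding two closed disks along their
boundaries is constant. -/
lemma constant_of_welded {u v σ : ℂ → ℂ} (hu : AnalyticOnNhd ℂ u (closedBall 0 1))
    (hv : AnalyticOnNhd ℂ v (closedBall 0 1)) (hσ : AnalyticOnNhd ℂ σ (sphere 0 1))
    (hσ1 : ∀ z, ‖z‖ = 1 → ‖σ z‖ = 1) (hσs : SurjOn σ (sphere 0 1) (sphere 0 1))
    (hσo : ∀ z₀, ‖z₀‖ = 1 → ∀ᶠ z in nhds z₀, 1 < ‖z‖ → ‖σ z‖ < 1)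
    (huv : ∀ z, ‖z‖ = 1 → u z = v (σ z)) :
    ∃ c, (∀ z, ‖z‖ ≤ 1 → u z = c) ∧ ∀ z, ‖z‖ ≤ 1 → v z = c := by
  have closure_ball' : closure (ball (0 : ℂ) 1) = closedBall 0 1 := closure_ball 0 one_ne_zero
  have frontier_ball' : frontier (ball (0 : ℂ) 1) = sphere 0 1 := frontier_ball 0 one_ne_zero
  have hdu : DiffContOnCl ℂ u (ball 0 1) :=
    ⟨fun z hz => (hu z (ball_subset_closedBall hz)).differentiableAt.differentiableWithinAt, by
      rw [closure_ball']; exact hu.continuousOn⟩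
  have hdv : DiffContOnCl ℂ v (ball 0 1) :=
    ⟨fun z hz => (hv z (ball_subset_closedBall hz)).differentiableAt.differentiableWithinAt, by
      rw [closure_ball']; exact hv.continuousOn⟩
  obtain ⟨z₀, hz₀, hmax⟩ := (isCompact_sphere (0 : ℂ) 1).exists_isMaxOn
    (NormedSpace.sphere_nonempty.2 zero_le_one)
    (hu.continuousOn.mono sphere_subset_closedBall).norm
  have hz₀' : ‖z₀‖ = 1 := by simpa using hz₀
  have hub : ∀ z, ‖z‖ ≤ 1 → ‖u z‖ ≤ ‖u z₀‖ := fun z hz =>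
    norm_le_of_forall_mem_frontier_norm_le isBounded_ball hdu
      (fun w hw => hmax (by rwa [frontier_ball'] at hw)) (by rw [closure_ball']; simpa using hz)
  have hvb : ∀ z, ‖z‖ ≤ 1 → ‖v z‖ ≤ ‖u z₀‖ := fun z hz =>
    norm_le_of_forall_mem_frontier_norm_le isBounded_ball hdv
      (fun w hw => by
        rw [frontier_ball'] at hw
        obtain ⟨y, hy, rfl⟩ := hσs hw
        rw [← huv y (by simpa using hy)]
        exact hmax hy) (by rw [closure_ball']; simpa using hz)
  -- the functions `u` and `v ∘ σ` agree near `z₀`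
  have hσz : ‖σ z₀‖ = 1 := hσ1 _ hz₀'
  have hcomp : AnalyticAt ℂ (fun z => v (σ z)) z₀ :=
    (hv (σ z₀) (by simp [hσz])).comp (hσ z₀ hz₀)
  have hfreq : ∃ᶠ z in nhdsWithin z₀ {z₀}ᶜ, u z = v (σ z) := by
    have h1 : Filter.Tendsto (fun θ : ℝ => z₀ * exp (θ * I)) (nhdsWithin 0 (Ioi 0))
        (nhdsWithin z₀ {z₀}ᶜ) := by
      refine tendsto_nhdsWithin_iff.2 ⟨?_, ?_⟩
      · have : Continuous fun θ : ℝ => z₀ * exp (θ * I) := by fun_prop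
        have h2 := this.tendsto 0
        simp only [ofReal_zero, zero_mul, exp_zero, mul_one] at h2
        exact h2.mono_left nhdsWithin_le_nhds
      · filter_upwards [Ioo_mem_nhdsGT Real.pi_pos] with θ hθ h
        have h2 : exp (θ * I) = 1 := by
          have hz0 : z₀ ≠ 0 := by rintro rfl; simp at hz₀'
          exact mul_left_cancel₀ hz0 (by simpa using h)
        have h3 := congrArg Complex.im h2
        rw [exp_ofReal_mul_I_im] at h3
        exact (Real.sin_pos_of_pos_of_lt_pi hθ.1 hθ.2).ne' (by simpa using h3)
    refine h1.frequently (Filter.Eventually.frequently ?_)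
    refine .of_forall fun θ => huv _ ?_
    rw [norm_mul, hz₀', norm_exp_ofReal_mul_I, one_mul]
  have heq : ∀ᶠ z in nhds z₀, u z = v (σ z) :=
    ((hu z₀ (sphere_subset_closedBall hz₀)).frequently_eq_iff_eventually_eq hcomp).1 hfreq
  have hloc : IsLocalMax (norm ∘ u) z₀ := by
    filter_upwards [heq, hσo z₀ hz₀'] with z h1 h2
    rcases le_or_gt ‖z‖ 1 with h | h
    · exact hub z h
    · simp only [Function.comp, h1]
      rw [← h1]
      exact (congrArg norm h1).trans_le (hvb _ (h2 h).le)
  have hconst : ∀ᶠ z in nhds z₀, u z = u z₀ := by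
    refine Complex.eventually_eq_of_isLocalMax_norm ?_ hloc
    filter_upwards [(hu z₀ (sphere_subset_closedBall hz₀)).eventually_analyticAt] with z hz
    exact hz.differentiableAt
  have hall : EqOn u (fun _ => u z₀) (closedBall 0 1) :=
    hu.eqOn_of_preconnected_of_eventuallyEq analyticOnNhd_const
      (convex_closedBall 0 1).isPreconnected (sphere_subset_closedBall hz₀) hconst
  refine ⟨u z₀, fun z hz => hall (by simpa using hz), fun z hz => ?_⟩
  refine eqOn_closure_of_eqOn_frontier (U := ball 0 1) isBounded_ball hdv
    (g := fun _ => u z₀) diffContOnCl_const (fun w hw => ?_) (by rw [closure_ball']; simpa using hz)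
  rw [frontier_ball'] at hw
  obtain ⟨y, hy, rfl⟩ := hσs hw
  rw [← huv y (by simpa using hy)]
  exact hall (sphere_subset_closedBall hy)

/-- The Fredholm alternative for infinite matrices with geometrically decaying columns, acting on
bounded sequences. -/
lemma exists_bounded_solution_of_unique {v : ℕ → ℕ → ℂ} {C t : ℝ} (ht0 : 0 ≤ t) (ht1 : t < 1)
    (hv : ∀ i m, ‖v i m‖ ≤ C * t ^ i)
    (huniq : ∀ (x : ℕ → ℂ) (A : ℝ), (∀ m, ‖x m‖ ≤ A) → (∀ m, x m = ∑' i, x i * v i m) →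
      ∀ m, x m = 0)
    {γ : ℕ → ℂ} {A : ℝ} (hγ : ∀ m, ‖γ m‖ ≤ A) :
    ∃ (x : ℕ → ℂ) (A' : ℝ), (∀ m, ‖x m‖ ≤ A') ∧ ∀ m, x m = γ m + ∑' i, x i * v i m := by
  let V : ℕ → BoundedContinuousFunction ℕ ℂ := fun i =>
    BoundedContinuousFunction.ofNormedAddCommGroupDiscrete (v i) (C * t ^ i) (hv i)
  let T : ℕ → BoundedContinuousFunction ℕ ℂ →L[ℂ] BoundedContinuousFunction ℕ ℂ := fun i =>
    (BoundedContinuousFunction.evalCLM ℂ i).smulRight (V i)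
  have hC : ∀ i, 0 ≤ C * t ^ i := fun i => (norm_nonneg _).trans (hv i 0)
  have hVn : ∀ i, ‖V i‖ ≤ C * t ^ i := fun i =>
    (BoundedContinuousFunction.norm_le (hC i)).2 (hv i)
  have hTn : ∀ i, ‖T i‖ ≤ C * t ^ i := fun i => by
    refine ContinuousLinearMap.opNorm_le_bound _ (hC i) fun x => ?_
    rw [ContinuousLinearMap.smulRight_apply, norm_smul, mul_comm]
    have h1 : ‖BoundedContinuousFunction.evalCLM ℂ i x‖ ≤ ‖x‖ := x.norm_coe_le_norm i
    have := hVn i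
    have := hC i
    gcongr
  have hsum : Summable T :=
    Summable.of_norm_bounded ((summable_geometric_of_lt_one ht0 ht1).mul_left C) hTn
  set K := ∑' i, T i with hK
  have hcomp : IsCompactOperator K := by
    refine isCompactOperator_of_tendsto hsum.hasSum (.of_forall fun S => ?_)
    induction S using Finset.induction_on with
    | empty => simpa using isCompactOperator_zero
    | insert i S hi ih =>
      rw [Finset.sum_insert hi]
      refine IsCompactOperator.add ?_ ih
      exact (isCompactOperator_of_locallyCompactSpace_dom
        (BoundedContinuousFunction.evalCLM ℂ i)).clm_comp (ContinuousLinearMap.toSpanSingleton ℂ (V i))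
  have happ : ∀ x m, K x m = ∑' i, x i * v i m := by
    intro x m
    have h1 := (hsum.hasSum.mapL (ContinuousLinearMap.apply ℂ _ x)).mapL
      (BoundedContinuousFunction.evalCLM ℂ m)
    exact h1.tsum_eq.symm
  rcases hcomp.hasEigenvalue_or_mem_resolventSet (μ := 1) one_ne_zero with h | h
  · obtain ⟨x, hx⟩ := h.exists_hasEigenvector
    exfalso
    apply hx.2
    ext m
    refine huniq x ‖x‖ (fun m => x.norm_coe_le_norm m) (fun m => ?_) m
    rw [← happ]
    have := hx.apply_eq_smul
    rw [one_smul] at this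
    exact (congrArg (fun y : BoundedContinuousFunction ℕ ℂ => y m) this).symm
  · rw [spectrum.mem_resolventSet_iff, map_one] at h
    let g : BoundedContinuousFunction ℕ ℂ :=
      BoundedContinuousFunction.ofNormedAddCommGroupDiscrete γ A hγ
    obtain ⟨U, hU⟩ := h
    let x := (↑U⁻¹ : BoundedContinuousFunction ℕ ℂ →L[ℂ] BoundedContinuousFunction ℕ ℂ) g
    have hx : x - K x = g := by
      have h1 : (U.val * U.inv) g = g := by rw [U.val_inv]; rfl
      rw [hU] at h1
      exact h1
    refine ⟨x, ‖x‖, fun m => x.norm_coe_le_norm m, fun m => ?_⟩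
    rw [← happ]
    have := congrArg (fun y : BoundedContinuousFunction ℕ ℂ => y m) hx
    simp only [BoundedContinuousFunction.sub_apply] at this
    have hg : g m = γ m := rfl
    linear_combination this + hg

lemma analyticAt_dslope {f : ℂ → ℂ} {a z : ℂ} (ha : AnalyticAt ℂ f a) (hz : AnalyticAt ℂ f z) :
    AnalyticAt ℂ (dslope f a) z := by
  rcases eq_or_ne z a with rfl | hza
  · obtain ⟨p, hp⟩ := hz
    exact hp.has_fpower_series_dslope_fslope.analyticAt
  · have : AnalyticAt ℂ (fun y => (f y - f a) / (y - a)) z :=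
      (hz.sub analyticAt_const).div (analyticAt_id.sub analyticAt_const) (sub_ne_zero.2 hza)
    refine this.congr ?_
    filter_upwards [isOpen_ne.mem_nhds hza] with y hy
    rw [dslope_of_ne _ hy, slope_def_field]

/-- A holomorphic map on the annulus `r₀ < ‖z‖ < R₀` which restricts to an orientation preserving
diffeomorphism of the unit circle and preserves its two sides. -/
structure WeldingMap (k : ℂ → ℂ) (r₀ R₀ : ℝ) : Prop where
  r₀_pos : 0 < r₀
  r₀_lt : r₀ < 1
  lt_R₀ : 1 < R₀
  analyticAt : ∀ z, r₀ < ‖z‖ → ‖z‖ < R₀ → AnalyticAt ℂ k z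
  ne_zero : ∀ z, r₀ < ‖z‖ → ‖z‖ < R₀ → k z ≠ 0
  norm_lt : ∀ z, r₀ < ‖z‖ → ‖z‖ < 1 → ‖k z‖ < 1
  norm_eq : ∀ z, ‖z‖ = 1 → ‖k z‖ = 1
  lt_norm : ∀ z, 1 < ‖z‖ → ‖z‖ < R₀ → 1 < ‖k z‖
  injOn : InjOn k (sphere 0 1)
  surjOn : SurjOn k (sphere 0 1) (sphere 0 1)
  deriv_ne_zero : ∀ z, ‖z‖ = 1 → deriv k z ≠ 0
  integral_logDeriv : (∮ z in C(0, 1), deriv k z / k z) = 2 * Real.pi * I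

namespace WeldingMap

variable {k : ℂ → ℂ} {r₀ R₀ : ℝ}

lemma continuousOn_sphere (hk : WeldingMap k r₀ R₀) {ρ : ℝ} (h1 : r₀ < ρ) (h2 : ρ < R₀) :
    ContinuousOn k (sphere 0 ρ) := fun z hz => by
  have hz' : ‖z‖ = ρ := by simpa using hz
  exact (hk.analyticAt z (by linarith) (by linarith)).continuousAt.continuousWithinAt

lemma continuousOn_deriv_sphere (hk : WeldingMap k r₀ R₀) {ρ : ℝ} (h1 : r₀ < ρ) (h2 : ρ < R₀) :
    ContinuousOn (deriv k) (sphere 0 ρ) := fun z hz => by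
  have hz' : ‖z‖ = ρ := by simpa using hz
  exact (hk.analyticAt z (by linarith) (by linarith)).deriv.continuousAt.continuousWithinAt

lemma continuousOn_inv_sphere (hk : WeldingMap k r₀ R₀) {ρ : ℝ} (h1 : r₀ < ρ) (h2 : ρ < R₀) :
    ContinuousOn (fun z => (k z)⁻¹) (sphere 0 ρ) :=
  (hk.continuousOn_sphere h1 h2).inv₀ fun z hz => by
    have hz' : ‖z‖ = ρ := by simpa using hz
    exact hk.ne_zero z (by linarith) (by linarith)

lemma exists_norm_le (hk : WeldingMap k r₀ R₀) {r : ℝ} (h1 : r₀ < r) (h2 : r < 1) :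
    ∃ s, 0 < s ∧ s < 1 ∧ ∀ z ∈ sphere (0 : ℂ) r, ‖k z‖ ≤ s := by
  have hr : 0 ≤ r := hk.r₀_pos.le.trans h1.le
  obtain ⟨z, hz, hmax⟩ := (isCompact_sphere (0 : ℂ) r).exists_isMaxOn
    (NormedSpace.sphere_nonempty.2 hr) (hk.continuousOn_sphere h1 (h2.trans hk.lt_R₀)).norm
  have hz' : ‖z‖ = r := by simpa using hz
  exact ⟨‖k z‖, norm_pos_iff.2 (hk.ne_zero z (by linarith) (by linarith [hk.lt_R₀])),
    hk.norm_lt z (by linarith) (by linarith), fun w hw => hmax hw⟩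

lemma exists_norm_inv_le (hk : WeldingMap k r₀ R₀) {R : ℝ} (h1 : 1 < R) (h2 : R < R₀) :
    ∃ t, 0 < t ∧ t < 1 ∧ ∀ z ∈ sphere (0 : ℂ) R, ‖(k z)⁻¹‖ ≤ t := by
  have hR : 0 ≤ R := by linarith
  obtain ⟨z, hz, hmax⟩ := (isCompact_sphere (0 : ℂ) R).exists_isMaxOn
    (NormedSpace.sphere_nonempty.2 hR) (hk.continuousOn_inv_sphere (hk.r₀_lt.trans h1) h2).norm
  have hz' : ‖z‖ = R := by simpa using hz
  refine ⟨‖(k z)⁻¹‖, norm_pos_iff.2 (inv_ne_zero (hk.ne_zero z (by linarith [hk.r₀_lt])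
    (by linarith))), ?_, fun w hw => hmax hw⟩
  rw [norm_inv]
  exact inv_lt_one_of_one_lt₀ (hk.lt_norm z (by linarith) (by linarith))

/-- A function analytic near the unit circle all of whose negative Fourier coefficients in the
coordinate `w = k z` vanish extends holomorphically to the `w`-disk. -/
lemma exists_eq_comp (hk : WeldingMap k r₀ R₀) {f : ℂ → ℂ} {r R : ℝ} (hr₀ : r₀ < r) (hr1 : r < 1)
    (hR1 : 1 < R) (hR₀ : R < R₀) (hf : ∀ z, r ≤ ‖z‖ → ‖z‖ ≤ R → AnalyticAt ℂ f z)
    (hmom : ∀ m : ℕ, (∮ z in C(0, r), f z * deriv k z * k z ^ m) = 0) :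
    ∃ c : ℂ → ℂ, AnalyticOnNhd ℂ c (closedBall 0 1) ∧ ∀ z, ‖z‖ = 1 → f z = c (k z) := by
  have hr : 0 < r := hk.r₀_pos.trans hr₀
  have hfc : ∀ ρ, r ≤ ρ → ρ ≤ R → ContinuousOn f (sphere 0 ρ) := fun ρ h1 h2 ζ hζ => by
    have : ‖ζ‖ = ρ := by simpa using hζ
    exact (hf ζ (by linarith) (by linarith)).continuousAt.continuousWithinAt
  obtain ⟨s, hs0, hs1, hs⟩ := hk.exists_norm_le hr₀ hr1
  obtain ⟨t, ht0, ht1, ht⟩ := hk.exists_norm_inv_le hR1 hR₀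
  have hkR := hk.continuousOn_inv_sphere (hk.r₀_lt.trans hR1) hR₀
  refine ⟨fun w => (2 * Real.pi * I)⁻¹ *
    ∮ ζ in C(0, R), f ζ * deriv k ζ * (k ζ)⁻¹ / (1 - w * (k ζ)⁻¹), fun w hw => ?_, fun z hz => ?_⟩
  · refine analyticAt_const.mul (analyticAt_circleIntegral_div (by linarith)
      (((hfc R (by linarith) le_rfl).mul
        (hk.continuousOn_deriv_sphere (hk.r₀_lt.trans hR1) hR₀)).mul hkR) hkR ht ?_)
    have : ‖w‖ ≤ 1 := by simpa using hw
    nlinarith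
  · have hkz : ‖k z‖ = 1 := hk.norm_eq z hz
    have hkz0 : k z ≠ 0 := by rw [← norm_pos_iff, hkz]; exact one_pos
    have hne : ∀ ζ, r ≤ ‖ζ‖ → ‖ζ‖ ≤ R → ζ ≠ z → k ζ ≠ k z := by
      intro ζ h1 h2 hζz heq
      have hn : ‖k ζ‖ = 1 := by rw [heq, hkz]
      rcases lt_trichotomy ‖ζ‖ 1 with h | h | h
      · exact (hk.norm_lt ζ (by linarith) h).ne hn
      · exact hζz (hk.injOn (by simpa using h) (by simpa using hz) heq)
      · exact (hk.lt_norm ζ h (by linarith)).ne' hn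
    have hkan : ∀ ζ, r ≤ ‖ζ‖ → ‖ζ‖ ≤ R → AnalyticAt ℂ k ζ := fun ζ h1 h2 =>
      hk.analyticAt ζ (by linarith) (by linarith)
    have hds : ∀ ζ, r ≤ ‖ζ‖ → ‖ζ‖ ≤ R → AnalyticAt ℂ (dslope k z) ζ := fun ζ h1 h2 =>
      analyticAt_dslope (hkan z (by linarith) (by linarith)) (hkan ζ h1 h2)
    have hds0 : ∀ ζ, r ≤ ‖ζ‖ → ‖ζ‖ ≤ R → dslope k z ζ ≠ 0 := by
      intro ζ h1 h2
      rcases eq_or_ne ζ z with rfl | hζz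
      · rw [dslope_same]
        exact hk.deriv_ne_zero ζ hz
      · rw [dslope_of_ne _ hζz, slope_def_field]
        exact div_ne_zero (sub_ne_zero.2 (hne ζ h1 h2 hζz)) (sub_ne_zero.2 hζz)
    have key := two_pi_I_mul_eq_circleIntegral_sub (f := fun ζ => f ζ * deriv k ζ / dslope k z ζ)
      (r := r) (R := R) (z := z) hr (fun ζ h1 h2 => ((hf ζ h1 h2).mul (hkan ζ h1 h2).deriv).div
        (hds ζ h1 h2) (hds0 ζ h1 h2)) (by linarith) (by linarith)
    have hquot : ∀ ζ, r ≤ ‖ζ‖ → ‖ζ‖ ≤ R → ζ ≠ z →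
        f ζ * deriv k ζ / dslope k z ζ / (ζ - z) = f ζ * deriv k ζ / (k ζ - k z) := by
      intro ζ h1 h2 hζz
      have := sub_ne_zero.2 (hne ζ h1 h2 hζz)
      have := sub_ne_zero.2 hζz
      rw [dslope_of_ne _ hζz, slope_def_field]
      field_simp
    have hin : (∮ ζ in C(0, r), f ζ * deriv k ζ / dslope k z ζ / (ζ - z)) = 0 := by
      have hgeo := hasSum_circleIntegral_geometric (f := fun ζ => f ζ * deriv k ζ) (q := k)
        (x := (k z)⁻¹) hr.le
        ((hfc r le_rfl (by linarith)).mul (hk.continuousOn_deriv_sphere hr₀ (by linarith)))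
        (hk.continuousOn_sphere hr₀ (by linarith)) hs (by rw [norm_inv, hkz]; linarith)
      simp only [hmom, mul_zero] at hgeo
      have h0 := hgeo.unique hasSum_zero
      calc _ = ∮ ζ in C(0, r), -(k z)⁻¹ * (f ζ * deriv k ζ / (1 - (k z)⁻¹ * k ζ)) := by
            refine circleIntegral.integral_congr hr.le fun ζ hζ => ?_
            have hζ' : ‖ζ‖ = r := by simpa using hζ
            have hζz : ζ ≠ z := by rintro rfl; linarith
            have h1 := sub_ne_zero.2 (hne ζ hζ'.ge (by linarith) hζz)
            have h2 : 1 - (k z)⁻¹ * k ζ = -(k z)⁻¹ * (k ζ - k z) := by field_simp; ring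
            have h3 : -(k z)⁻¹ ≠ 0 := neg_ne_zero.2 (inv_ne_zero hkz0)
            rw [hquot ζ hζ'.ge (by linarith) hζz, h2, ← mul_div_assoc, mul_div_mul_left _ _ h3]
        _ = 0 := by rw [circleIntegral.integral_const_mul, h0, mul_zero]
    have hout : (∮ ζ in C(0, R), f ζ * deriv k ζ / dslope k z ζ / (ζ - z)) =
        ∮ ζ in C(0, R), f ζ * deriv k ζ * (k ζ)⁻¹ / (1 - k z * (k ζ)⁻¹) := by
      refine circleIntegral.integral_congr (by linarith) fun ζ hζ => ?_
      have hζ' : ‖ζ‖ = R := by simpa using hζ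
      have hζz : ζ ≠ z := by rintro rfl; linarith
      have h0 : k ζ ≠ 0 := hk.ne_zero ζ (by linarith [hk.r₀_lt]) (by linarith)
      have h2 : 1 - k z * (k ζ)⁻¹ = (k ζ - k z) * (k ζ)⁻¹ := by field_simp
      rw [hquot ζ (by linarith) hζ'.le hζz, h2, mul_div_mul_right _ _ (inv_ne_zero h0)]
    rw [hin, hout, sub_zero, dslope_same, mul_div_assoc, div_self (hk.deriv_ne_zero z hz),
      mul_one] at key
    simp only
    rw [← key, ← mul_assoc, inv_mul_cancel₀ two_pi_I_ne_zero, one_mul]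

end WeldingMap

lemma analyticAt_cauchyTransform {f : ℂ → ℂ} {R : ℝ} (hf : ContinuousOn f (sphere 0 R)) {z : ℂ}
    (hz : ‖z‖ < R) : AnalyticAt ℂ (fun y => ∮ ζ in C(0, R), f ζ / (ζ - y)) z := by
  have hR : 0 < R := (norm_nonneg z).trans_lt hz
  have h0 : ∀ ζ ∈ sphere (0 : ℂ) R, ζ ≠ 0 := fun ζ hζ => ne_of_mem_sphere hζ hR.ne'
  have hinv : ContinuousOn (fun ζ : ℂ => ζ⁻¹) (sphere 0 R) := continuousOn_id.inv₀ h0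
  have key := analyticAt_circleIntegral_div (f := fun ζ => f ζ * ζ⁻¹) (q := fun ζ => ζ⁻¹)
    (s := R⁻¹) (x := z) hR.le (hf.mul hinv) hinv
    (fun ζ hζ => by
      have hζ' : ‖ζ‖ = R := by simpa using hζ
      rw [norm_inv, hζ'])
    (by rw [← div_eq_mul_inv, div_lt_one hR]; exact hz)
  refine key.congr (.of_forall fun y => circleIntegral.integral_congr hR.le fun ζ hζ => ?_)
  have h := h0 ζ hζ
  have h2 : 1 - y * ζ⁻¹ = (ζ - y) * ζ⁻¹ := by field_simp
  simp only [h2]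
  rw [mul_div_mul_right _ _ (inv_ne_zero h)]

namespace WeldingMap

variable {k : ℂ → ℂ} {r₀ R₀ : ℝ}

lemma exists_lt_norm (hk : WeldingMap k r₀ R₀) {r s : ℝ} (hr : r < 1) (hs : s < 1) :
    ∃ r₁, r < r₁ ∧ r₀ < r₁ ∧ r₁ < 1 ∧ ∀ z, r₁ ≤ ‖z‖ → ‖z‖ < R₀ → s < ‖k z‖ := by
  have hnhds : {z : ℂ | s < ‖k z‖} ∈ nhdsSet (sphere (0 : ℂ) 1) := by
    rw [mem_nhdsSet_iff_forall]
    intro z hz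
    have hz' : ‖z‖ = 1 := by simpa using hz
    have := (hk.analyticAt z (by linarith [hk.r₀_lt]) (by linarith [hk.lt_R₀])).continuousAt.norm
    exact this.eventually (lt_mem_nhds (by simpa only [hk.norm_eq z hz'] using hs))
  obtain ⟨U, hUo, hU1, hU2⟩ := mem_nhdsSet_iff_exists.1 hnhds
  obtain ⟨δ, hδ, hsub⟩ := (isCompact_sphere (0 : ℂ) 1).exists_thickening_subset_open hUo hU1
  have hmax : max (max r r₀) (max (1 - δ) 0) < 1 := by
    simp [hr, hk.r₀_lt, hδ]
  obtain ⟨r₁, h1, h2⟩ := exists_between hmax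
  simp only [max_lt_iff] at h1
  refine ⟨r₁, h1.1.1, h1.1.2, h2, fun z hz1 hz2 => ?_⟩
  rcases le_or_gt ‖z‖ 1 with h | h
  · refine hU2 (hsub ?_)
    have hz0 : 0 < ‖z‖ := by linarith
    rw [mem_thickening_iff]
    refine ⟨z / ‖z‖, by simp [hz0.ne'], ?_⟩
    have : z - z / ‖z‖ = z / ‖z‖ * ((‖z‖ - 1 : ℝ) : ℂ) := by
      have : (‖z‖ : ℂ) ≠ 0 := by exact_mod_cast hz0.ne'
      push_cast
      field_simp
    rw [dist_eq_norm, this, norm_mul, norm_real, norm_div, norm_real, norm_norm,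
      div_self hz0.ne', one_mul, Real.norm_eq_abs, abs_of_nonpos (by linarith)]
    linarith [h1.2.1]
  · linarith [hk.lt_norm z h hz2]

lemma analyticAt_reciprocal (hk : WeldingMap k r₀ R₀) {z : ℂ} (h1 : r₀ < ‖z‖) (h2 : ‖z‖ < R₀) :
    AnalyticAt ℂ (fun z => (k z)⁻¹) z :=
  (hk.analyticAt z h1 h2).inv (hk.ne_zero z h1 h2)

lemma integral_deriv_mul_zpow (hk : WeldingMap k r₀ R₀) {p : ℤ} (hp : p ≠ -1) :
    (∮ z in C(0, 1), deriv k z * k z ^ p) = 0 := by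
  have hp' : ((p + 1 : ℤ) : ℂ) ≠ 0 := by
    exact_mod_cast fun h : p + 1 = 0 => hp (by omega)
  refine circleIntegral.integral_eq_zero_of_hasDerivWithinAt
    (f := fun z => k z ^ (p + 1) / ((p + 1 : ℤ) : ℂ)) zero_le_one fun z hz => ?_
  have hz' : ‖z‖ = 1 := by simpa using hz
  have h1 : r₀ < ‖z‖ := by linarith [hk.r₀_lt]
  have h2 : ‖z‖ < R₀ := by linarith [hk.lt_R₀]
  have hd := ((hasDerivAt_zpow (p + 1) (k z) (.inl (hk.ne_zero z h1 h2))).comp z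
    (hk.analyticAt z h1 h2).differentiableAt.hasDerivAt).div_const ((p + 1 : ℤ) : ℂ)
  refine (hd.congr_deriv ?_).hasDerivWithinAt
  rw [add_sub_cancel_right]
  field_simp

/-- The negative Fourier coefficients of `(ε w + ∑ x i w ^ (-i - 1)) ∘ k` in the coordinate
`w = k z`. -/
lemma integral_moment (hk : WeldingMap k r₀ R₀) {x : ℕ → ℂ} {C s : ℝ} (hs0 : 0 ≤ s) (hs1 : s < 1)
    (hx : ∀ m, ‖x m‖ ≤ C * s ^ m) (ε : ℂ) (m : ℕ) :
    (∮ z in C(0, 1), (ε * k z + (k z)⁻¹ * ∑' i, x i * (k z)⁻¹ ^ i) * deriv k z * k z ^ m) =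
      2 * Real.pi * I * x m := by
  have hne : ∀ z ∈ sphere (0 : ℂ) 1, k z ≠ 0 := fun z hz => by
    rw [← norm_pos_iff, hk.norm_eq z (by simpa using hz)]; exact one_pos
  have hkc := hk.continuousOn_sphere hk.r₀_lt hk.lt_R₀
  have hkd := hk.continuousOn_deriv_sphere hk.r₀_lt hk.lt_R₀
  have hki := hk.continuousOn_inv_sphere hk.r₀_lt hk.lt_R₀
  have hn1 : ∀ z ∈ sphere (0 : ℂ) 1, ‖(k z)⁻¹‖ = 1 := fun z hz => by
    rw [norm_inv, hk.norm_eq z (by simpa using hz), inv_one]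
  obtain ⟨M, hM⟩ := (isCompact_sphere (0 : ℂ) 1).exists_bound_of_continuousOn hkd
  have hsum := hasSum_circleIntegral_of_norm_le (ρ := 1)
    (F := fun i z => x i * ((k z)⁻¹ ^ (i + 1) * (deriv k z * k z ^ m)))
    (u := fun i => C * s ^ i * M) zero_le_one
    (fun i => continuousOn_const.mul ((hki.pow _).mul (hkd.mul (hkc.pow m))))
    (((summable_geometric_of_lt_one hs0 hs1).mul_left C).mul_right M) fun i z hz => by
      rw [norm_mul, norm_mul, norm_pow, hn1 z hz, one_pow, one_mul, norm_mul, norm_pow,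
        hk.norm_eq z (by simpa using hz), one_pow, mul_one]
      have h1 := hx i
      have h2 := hM z hz
      have h3 := (norm_nonneg _).trans h1
      gcongr
  have hterm : ∀ i, (∮ z in C(0, 1), x i * ((k z)⁻¹ ^ (i + 1) * (deriv k z * k z ^ m))) =
      if i = m then 2 * Real.pi * I * x m else 0 := by
    intro i
    rw [circleIntegral.integral_const_mul]
    have hcongr : (∮ z in C(0, 1), ((k z)⁻¹ ^ (i + 1) * (deriv k z * k z ^ m))) =
        ∮ z in C(0, 1), deriv k z * k z ^ ((m : ℤ) - (i + 1)) := by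
      refine circleIntegral.integral_congr zero_le_one fun z hz => ?_
      have h := hne z hz
      rw [zpow_sub₀ h, zpow_natCast, inv_pow]
      norm_cast
      field_simp
    rw [hcongr]
    split_ifs with h
    · subst h
      rw [← hk.integral_logDeriv, mul_comm]
      congr 1
      refine circleIntegral.integral_congr zero_le_one fun z hz => ?_
      simp only [sub_add_cancel_left, zpow_neg, zpow_one, div_eq_mul_inv]
    · rw [hk.integral_deriv_mul_zpow (by omega), mul_zero]
  simp only [hterm] at hsum
  have hval := hsum.tsum_eq
  rw [tsum_ite_eq] at hval
  have hlin : ∀ z ∈ sphere (0 : ℂ) 1,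
      (ε * k z + (k z)⁻¹ * ∑' i, x i * (k z)⁻¹ ^ i) * deriv k z * k z ^ m =
      ε * (deriv k z * k z ^ ((m : ℤ) + 1)) +
        ∑' i, x i * ((k z)⁻¹ ^ (i + 1) * (deriv k z * k z ^ m)) := by
    intro z hz
    have h1 : ∑' i, x i * ((k z)⁻¹ ^ (i + 1) * (deriv k z * k z ^ m)) =
        (k z)⁻¹ * (∑' i, x i * (k z)⁻¹ ^ i) * (deriv k z * k z ^ m) := by
      rw [← tsum_mul_left, ← tsum_mul_right]
      refine tsum_congr fun i => ?_
      ring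
    have h2 : k z ^ ((m : ℤ) + 1) = k z ^ m * k z := by
      rw [zpow_add_one₀ (hne z hz), zpow_natCast]
    rw [h1, h2]
    ring
  have hT : ContinuousOn
      (fun z => ∑' i, x i * ((k z)⁻¹ ^ (i + 1) * (deriv k z * k z ^ m))) (sphere 0 1) := by
    refine continuousOn_tsum
      (fun i => continuousOn_const.mul ((hki.pow _).mul (hkd.mul (hkc.pow m))))
      (((summable_geometric_of_lt_one hs0 hs1).mul_left C).mul_right M) fun i z hz => ?_
    rw [norm_mul, norm_mul, norm_pow, hn1 z hz, one_pow, one_mul, norm_mul, norm_pow,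
      hk.norm_eq z (by simpa using hz), one_pow, mul_one]
    have h1 := hx i
    have h2 := hM z hz
    have h3 := (norm_nonneg _).trans h1
    gcongr
  rw [circleIntegral.integral_congr zero_le_one hlin, circleIntegral.integral_add,
    circleIntegral.integral_const_mul, hk.integral_deriv_mul_zpow (by omega), mul_zero, zero_add,
    hval]
  · refine ContinuousOn.circleIntegrable zero_le_one (continuousOn_const.mul (hkd.mul ?_))
    exact hkc.zpow₀ _ fun z hz => .inl (hne z hz)
  · exact hT.circleIntegrable zero_le_one

/-- A solution of the moment system yields a pair of functions, holomorphic in the `z`-disk and in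
the exterior of the `w`-disk, which match along `w = k z`. -/
lemma eq_of_moments (hk : WeldingMap k r₀ R₀) {r R : ℝ} (hr₀ : r₀ < r) (hr1 : r < 1)
    (hR1 : 1 < R) (hR₀ : R < R₀) {ε : ℂ} {x : ℕ → ℂ} {A : ℝ} (hx : ∀ m, ‖x m‖ ≤ A) {φ : ℂ → ℂ}
    (hφ : ∀ z, φ z = (2 * Real.pi * I)⁻¹ * ∮ ζ in C(0, R),
      (ε * k ζ + (k ζ)⁻¹ * ∑' i, x i * (k ζ)⁻¹ ^ i) / (ζ - z))
    (hmom : ∀ m : ℕ, x m = (2 * Real.pi * I)⁻¹ * ∮ z in C(0, r), φ z * deriv k z * k z ^ m) :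
    AnalyticOnNhd ℂ φ (closedBall 0 1) ∧
    AnalyticOnNhd ℂ (fun ω => ∑' i, x i * ω ^ i) (closedBall 0 1) ∧
    ∀ z, ‖z‖ = 1 → φ z = ε * k z + (k z)⁻¹ * ∑' i, x i * (k z)⁻¹ ^ i := by
  have hr : 0 < r := hk.r₀_pos.trans hr₀
  obtain ⟨s, hs0, hs1, hs⟩ := hk.exists_norm_le hr₀ hr1
  obtain ⟨t, ht0, ht1, ht⟩ := hk.exists_norm_inv_le hR1 hR₀
  set f : ℂ → ℂ := fun ζ => ε * k ζ + (k ζ)⁻¹ * ∑' i, x i * (k ζ)⁻¹ ^ i with hf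
  have hfR : ContinuousOn f (sphere 0 R) := by
    intro ζ hζ
    have hζ' : ‖ζ‖ = R := by simpa using hζ
    have h1 : r₀ < ‖ζ‖ := by linarith [hk.r₀_lt]
    have h2 : ‖ζ‖ < R₀ := by linarith
    have hg : AnalyticAt ℂ (fun ω => ∑' i, x i * ω ^ i) (k ζ)⁻¹ :=
      analyticAt_tsum_mul_pow zero_le_one (C := A) (by simpa using hx)
        (by linarith [ht ζ hζ])
    have : AnalyticAt ℂ f ζ := (analyticAt_const.mul (hk.analyticAt ζ h1 h2)).add
      ((hk.analyticAt_reciprocal h1 h2).mul (hg.comp (f := fun z => (k z)⁻¹) (hk.analyticAt_reciprocal h1 h2)))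
    exact this.continuousAt.continuousWithinAt
  have hφan : ∀ z, ‖z‖ < R → AnalyticAt ℂ φ z := fun z hz =>
    (analyticAt_const.mul (analyticAt_cauchyTransform hfR hz)).congr
      (.of_forall fun y => (hφ y).symm)
  have hφc : ∀ ρ, ρ < R → ContinuousOn φ (sphere 0 ρ) := fun ρ hρ z hz =>
    (hφan z (by rw [mem_sphere_zero_iff_norm.1 hz]; exact hρ)).continuousAt.continuousWithinAt
  obtain ⟨C, hC, hxs⟩ : ∃ C : ℝ, 0 ≤ C ∧ ∀ m, ‖x m‖ ≤ C * s ^ m := by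
    obtain ⟨C, hC, h⟩ := exists_norm_circleIntegral_mul_pow_le
      (f := fun z => φ z * deriv k z) (q := k) hr.le
      ((hφc r (by linarith)).mul (hk.continuousOn_deriv_sphere hr₀ (by linarith))) hs
    refine ⟨‖(2 * Real.pi * I : ℂ)⁻¹‖ * C, by positivity, fun m => ?_⟩
    rw [hmom m, norm_mul, mul_assoc ‖_‖]
    exact mul_le_mul_of_nonneg_left (h m) (norm_nonneg _)
  have hg : ∀ ω : ℂ, ‖ω‖ * s < 1 → AnalyticAt ℂ (fun ω => ∑' i, x i * ω ^ i) ω := fun ω hω =>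
    analyticAt_tsum_mul_pow hs0.le hxs hω
  refine ⟨fun z hz => hφan z ?_, fun ω hω => hg ω ?_, ?_⟩
  · have : ‖z‖ ≤ 1 := by simpa using hz
    linarith
  · have : ‖ω‖ ≤ 1 := by simpa using hω
    nlinarith
  obtain ⟨r₁, hr₁r, hr₁0, hr₁1, hr₁⟩ := hk.exists_lt_norm hr1 hs1
  have hr₁pos : 0 < r₁ := hr.trans hr₁r
  have hfan : ∀ z, r₁ ≤ ‖z‖ → ‖z‖ ≤ R → AnalyticAt ℂ f z := by
    intro z h1 h2
    have h3 : r₀ < ‖z‖ := by linarith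
    have h4 : ‖z‖ < R₀ := by linarith
    have h5 : ‖(k z)⁻¹‖ * s < 1 := by
      have := hr₁ z h1 h4
      rw [norm_inv, inv_mul_eq_div, div_lt_one (hs0.trans this)]
      exact this
    exact (analyticAt_const.mul (hk.analyticAt z h3 h4)).add
      ((hk.analyticAt_reciprocal h3 h4).mul ((hg _ h5).comp (f := fun z => (k z)⁻¹)
        (hk.analyticAt_reciprocal h3 h4)))
  -- the part of `f` that is holomorphic outside the disk, in the coordinate `1 / z`
  set b : ℂ → ℂ := fun η => η * ((2 * Real.pi * I)⁻¹ * ∮ ζ in C(0, r₁), f ζ / (1 - η * ζ)) with hb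
  have hfr₁ : ContinuousOn f (sphere 0 r₁) := fun ζ hζ => by
    have hζ' : ‖ζ‖ = r₁ := by simpa using hζ
    exact (hfan ζ hζ'.ge (by linarith)).continuousAt.continuousWithinAt
  have hban : ∀ η : ℂ, ‖η‖ * r₁ < 1 → AnalyticAt ℂ b η := fun η hη =>
    analyticAt_id.mul (analyticAt_const.mul (analyticAt_circleIntegral_div hr₁pos.le hfr₁
      continuousOn_id (fun ζ hζ => (mem_sphere_zero_iff_norm.1 hζ).le) hη))
  have hdecomp : ∀ z, r₁ < ‖z‖ → ‖z‖ < R → f z - φ z = b z⁻¹ := by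
    intro z h1 h2
    have hz0 : z ≠ 0 := by rw [← norm_pos_iff]; linarith
    have key := two_pi_I_mul_eq_circleIntegral_sub hr₁pos hfan h1 h2
    have h3 : (∮ ζ in C(0, r₁), f ζ / (ζ - z)) =
        -z⁻¹ * ∮ ζ in C(0, r₁), f ζ / (1 - z⁻¹ * ζ) := by
      rw [← circleIntegral.integral_const_mul]
      refine circleIntegral.integral_congr hr₁pos.le fun ζ hζ => ?_
      have hζ' : ‖ζ‖ = r₁ := by simpa using hζ
      have hne : ζ - z ≠ 0 := fun h => by rw [sub_eq_zero.1 h] at hζ'; linarith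
      have h4 : 1 - z⁻¹ * ζ = -z⁻¹ * (ζ - z) := by field_simp; ring
      rw [h4, ← mul_div_assoc, mul_div_mul_left _ _ (neg_ne_zero.2 (inv_ne_zero hz0))]
    rw [h3] at key
    have hpi := two_pi_I_ne_zero
    have hφz : 2 * Real.pi * I * φ z = ∮ ζ in C(0, R), f ζ / (ζ - z) := by
      rw [hφ z, ← mul_assoc, mul_inv_cancel₀ hpi, one_mul]
    rw [← hφz] at key
    refine mul_left_cancel₀ hpi ?_
    have hbz : 2 * Real.pi * I * b z⁻¹ = z⁻¹ * ∮ ζ in C(0, r₁), f ζ / (1 - z⁻¹ * ζ) := by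
      rw [hb, mul_left_comm, ← mul_assoc (2 * Real.pi * I : ℂ), mul_inv_cancel₀ hpi, one_mul]
    rw [hbz]
    linear_combination key
  obtain ⟨r₂, hr₂1, hr₂2⟩ := exists_between hr₁1
  obtain ⟨R₂, hR₂1, hR₂2⟩ := exists_between hR1
  have hdan : ∀ z, r₂ ≤ ‖z‖ → ‖z‖ ≤ R₂ → AnalyticAt ℂ (fun z => f z - φ z) z := fun z h1 h2 =>
    (hfan z (by linarith) (by linarith)).sub (hφan z (by linarith))
  have hdmom : ∀ m : ℕ, (∮ z in C(0, r₂), (f z - φ z) * deriv k z * k z ^ m) = 0 := by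
    intro m
    have hkan : ∀ z, r ≤ ‖z‖ → ‖z‖ ≤ 1 → AnalyticAt ℂ k z := fun z h1 h2 =>
      hk.analyticAt z (by linarith) (by linarith)
    rw [← circleIntegral_eq_of_annulus (f := fun z => (f z - φ z) * deriv k z * k z ^ m) (R := 1) (by linarith) hr₂2.le fun z h1 h2 =>
      (((hdan z h1 (by linarith)).mul (hkan z (by linarith) h2).deriv).mul
        ((hkan z (by linarith) h2).pow m)).differentiableAt]
    have hφint : (∮ z in C(0, 1), φ z * deriv k z * k z ^ m) = 2 * Real.pi * I * x m := by
      rw [circleIntegral_eq_of_annulus (f := fun z => φ z * deriv k z * k z ^ m) hr hr1.le fun z h1 h2 =>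
        (((hφan z (by linarith)).mul (hkan z h1 h2).deriv).mul
          ((hkan z h1 h2).pow m)).differentiableAt, hmom m, ← mul_assoc,
        mul_inv_cancel₀ two_pi_I_ne_zero, one_mul]
    have hfint := hk.integral_moment hs0.le hs1 hxs ε m
    have hkm := (hk.continuousOn_sphere hk.r₀_lt hk.lt_R₀).pow m
    have hkd := hk.continuousOn_deriv_sphere hk.r₀_lt hk.lt_R₀
    have hf1 : ContinuousOn f (sphere 0 1) := fun ζ hζ => by
      have hζ' : ‖ζ‖ = 1 := by simpa using hζ
      exact (hfan ζ (by linarith) (by linarith)).continuousAt.continuousWithinAt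
    simp_rw [sub_mul]
    rw [circleIntegral.integral_sub (f := fun z => f z * deriv k z * k z ^ m)
      (g := fun z => φ z * deriv k z * k z ^ m) (((hf1.mul hkd).mul hkm).circleIntegrable zero_le_one)
      ((((hφc 1 hR1).mul hkd).mul hkm).circleIntegrable zero_le_one), hφint, hfint, sub_self]
  obtain ⟨c, hc, hcb⟩ := hk.exists_eq_comp (hr₁0.trans hr₂1) hr₂2 hR₂1 (hR₂2.trans hR₀) hdan hdmom
  obtain ⟨c₀, hc₀, -⟩ := constant_of_welded (u := b) (v := c) (σ := fun z => k z⁻¹)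
    (fun η hη => hban η (by
      have : ‖η‖ ≤ 1 := by simpa using hη
      nlinarith)) hc
    (fun z hz => by
      have hz' : ‖z‖ = 1 := by simpa using hz
      have hz0 : z ≠ 0 := by rw [← norm_pos_iff]; linarith
      exact (hk.analyticAt z⁻¹ (by rw [norm_inv, hz', inv_one]; exact hk.r₀_lt)
        (by rw [norm_inv, hz', inv_one]; exact hk.lt_R₀)).comp (_root_.analyticAt_inv hz0))
    (fun z hz => hk.norm_eq _ (by rw [norm_inv, hz, inv_one]))
    (fun w hw => by
      obtain ⟨z, hz, rfl⟩ := hk.surjOn hw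
      refine ⟨z⁻¹, ?_, by simp⟩
      rw [mem_sphere_zero_iff_norm] at hz ⊢
      rw [norm_inv, hz, inv_one])
    (fun z₀ hz₀ => by
      have : ∀ᶠ z : ℂ in nhds z₀, ‖z‖ < r₀⁻¹ :=
        continuous_norm.continuousAt.eventually (gt_mem_nhds (by
          simpa only [hz₀] using (one_lt_inv₀ hk.r₀_pos).2 hk.r₀_lt))
      filter_upwards [this] with z h1 h2
      refine hk.norm_lt _ ?_ ?_ <;> rw [norm_inv]
      · exact (lt_inv_comm₀ hk.r₀_pos (by linarith)).2 h1
      · exact inv_lt_one_of_one_lt₀ h2)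
    (fun z hz => by
      have h1 : ‖z⁻¹‖ = 1 := by rw [norm_inv, hz, inv_one]
      rw [← hcb _ h1, hdecomp _ (by linarith) (by linarith), inv_inv])
  have hb0 : c₀ = 0 := by rw [← hc₀ 0 (by simp), hb]; simp
  intro z hz
  have h1 := hdecomp z (by linarith) (by linarith)
  rw [hc₀ _ (by rw [norm_inv, hz, inv_one]), hb0] at h1
  exact (sub_eq_zero.1 h1).symm

end WeldingMap

lemma norm_cauchyTransform_le {f : ℂ → ℂ} {R U : ℝ} {z : ℂ} (hz : ‖z‖ < R)
    (hf : ∀ ζ ∈ sphere (0 : ℂ) R, ‖f ζ‖ ≤ U) :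
    ‖∮ ζ in C(0, R), f ζ / (ζ - z)‖ ≤ 2 * Real.pi * R * (U / (R - ‖z‖)) := by
  refine circleIntegral.norm_integral_le_of_norm_le_const ((norm_nonneg z).trans hz.le)
    fun ζ hζ => ?_
  have h1 : R - ‖z‖ ≤ ‖ζ - z‖ := by
    rw [← mem_sphere_zero_iff_norm.1 hζ]
    exact norm_sub_norm_le ζ z
  have h2 := hf ζ hζ
  have h3 : 0 < R - ‖z‖ := sub_pos.2 hz
  have h4 := (norm_nonneg _).trans h2
  rw [norm_div]
  gcongr

lemma hasSum_integral_cauchyTransform_mul {F : ℕ → ℂ → ℂ} {u : ℕ → ℝ} {h : ℂ → ℂ} {r R : ℝ}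
    (hr : 0 ≤ r) (hrR : r < R) (hF : ∀ i, ContinuousOn (F i) (sphere 0 R)) (hu : Summable u)
    (hFu : ∀ i, ∀ ζ ∈ sphere (0 : ℂ) R, ‖F i ζ‖ ≤ u i) (hh : ContinuousOn h (sphere 0 r)) :
    HasSum (fun i => ∮ z in C(0, r), (∮ ζ in C(0, R), F i ζ / (ζ - z)) * h z)
      (∮ z in C(0, r), (∮ ζ in C(0, R), (∑' i, F i ζ) / (ζ - z)) * h z) := by
  obtain ⟨M, hM⟩ := (isCompact_sphere (0 : ℂ) r).exists_bound_of_continuousOn hh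
  have hR : 0 < R := hr.trans_lt hrR
  have hinner : ∀ z ∈ sphere (0 : ℂ) r, (∮ ζ in C(0, R), (∑' i, F i ζ) / (ζ - z)) * h z =
      ∑' i, (∮ ζ in C(0, R), F i ζ / (ζ - z)) * h z := by
    intro z hz
    have hz' : ‖z‖ = r := by simpa using hz
    have hne : ∀ ζ ∈ sphere (0 : ℂ) R, ζ - z ≠ 0 := fun ζ hζ h => by
      rw [sub_eq_zero.1 h, mem_sphere_zero_iff_norm] at hζ
      linarith
    have hinv : ContinuousOn (fun ζ => (ζ - z)⁻¹) (sphere 0 R) :=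
      (continuousOn_id.sub continuousOn_const).inv₀ hne
    have hsum := hasSum_circleIntegral_of_norm_le (F := fun i ζ => F i ζ / (ζ - z))
      (u := fun i => u i * (R - r)⁻¹) hR.le
      (fun i => (hF i).div (continuousOn_id.sub continuousOn_const) hne) (hu.mul_right _)
      fun i ζ hζ => by
        have h1 : R - r ≤ ‖ζ - z‖ := by
          rw [← mem_sphere_zero_iff_norm.1 hζ, ← hz']
          exact norm_sub_norm_le ζ z
        have h2 := hFu i ζ hζ
        have h3 : 0 < R - r := sub_pos.2 hrR
        have h4 := (norm_nonneg _).trans h2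
        rw [norm_div, ← div_eq_mul_inv]
        gcongr
    rw [tsum_mul_right, hsum.tsum_eq]
    simp_rw [tsum_div_const]
  rw [circleIntegral.integral_congr hr hinner]
  refine hasSum_circleIntegral_of_norm_le (u := fun i => 2 * Real.pi * R * (u i / (R - r)) * M) hr
    (fun i => ContinuousOn.mul (fun z hz => ?_) hh)
    (((hu.div_const _).mul_left _).mul_right _) fun i z hz => ?_
  · exact (analyticAt_cauchyTransform (hF i)
      (by rw [mem_sphere_zero_iff_norm.1 hz]; exact hrR)).continuousAt.continuousWithinAt
  · have hz' : ‖z‖ = r := by simpa using hz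
    have h1 := norm_cauchyTransform_le (by rw [hz']; exact hrR) (hFu i)
    rw [hz'] at h1
    rw [norm_mul]
    exact mul_le_mul h1 (hM z hz) (norm_nonneg _) ((norm_nonneg _).trans h1)

namespace WeldingMap

variable {k : ℂ → ℂ} {r₀ R₀ : ℝ}

lemma constant_of_eq_comp_inv (hk : WeldingMap k r₀ R₀) {u v : ℂ → ℂ}
    (hu : AnalyticOnNhd ℂ u (closedBall 0 1)) (hv : AnalyticOnNhd ℂ v (closedBall 0 1))
    (huv : ∀ z, ‖z‖ = 1 → u z = v (k z)⁻¹) :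
    ∃ c, (∀ z, ‖z‖ ≤ 1 → u z = c) ∧ ∀ z, ‖z‖ ≤ 1 → v z = c := by
  refine constant_of_welded (σ := fun z => (k z)⁻¹) hu hv (fun z hz => ?_) (fun z hz => ?_)
    (fun w hw => ?_) (fun z₀ hz₀ => ?_) huv
  · have hz' : ‖z‖ = 1 := by simpa using hz
    exact hk.analyticAt_reciprocal (by linarith [hk.r₀_lt]) (by linarith [hk.lt_R₀])
  · rw [norm_inv, hk.norm_eq z hz, inv_one]
  · obtain ⟨z, hz, h⟩ := hk.surjOn (show w⁻¹ ∈ sphere (0 : ℂ) 1 by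
      rw [mem_sphere_zero_iff_norm] at hw ⊢
      rw [norm_inv, hw, inv_one])
    exact ⟨z, hz, by simp [h]⟩
  · have : ∀ᶠ z : ℂ in nhds z₀, ‖z‖ < R₀ :=
      continuous_norm.continuousAt.eventually (gt_mem_nhds (by simpa only [hz₀] using hk.lt_R₀))
    filter_upwards [this] with z h1 h2
    rw [norm_inv]
    exact inv_lt_one_of_one_lt₀ (hk.lt_norm z h2 h1)

/-- Every welding map is the boundary identification of a holomorphic function on the disk and a
holomorphic function on the exterior of the disk, normalized as `w + O(1 / w)`. -/
theorem exists_welding (hk : WeldingMap k r₀ R₀) :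
    ∃ φ G : ℂ → ℂ, AnalyticOnNhd ℂ φ (closedBall 0 1) ∧ AnalyticOnNhd ℂ G (closedBall 0 1) ∧
      ∀ z, ‖z‖ = 1 → φ z = k z + G (k z)⁻¹ := by
  obtain ⟨r, hr₀, hr1⟩ := exists_between hk.r₀_lt
  obtain ⟨R, hR1, hR₀⟩ := exists_between hk.lt_R₀
  have hr : 0 < r := hk.r₀_pos.trans hr₀
  have hrR : r < R := hr1.trans hR1
  obtain ⟨s, hs0, hs1, hs⟩ := hk.exists_norm_le hr₀ hr1
  obtain ⟨t, ht0, ht1, ht⟩ := hk.exists_norm_inv_le hR1 hR₀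
  have hkr := hk.continuousOn_sphere hr₀ (hrR.trans hR₀)
  have hkd := hk.continuousOn_deriv_sphere hr₀ (hrR.trans hR₀)
  have hkR := hk.continuousOn_sphere (hr₀.trans hrR) hR₀
  have hki := hk.continuousOn_inv_sphere (hr₀.trans hrR) hR₀
  have hh : ∀ m : ℕ, ContinuousOn (fun z => deriv k z * k z ^ m) (sphere 0 r) := fun m =>
    hkd.mul (hkr.pow m)
  set c₀ : ℂ := (2 * Real.pi * I)⁻¹ * (2 * Real.pi * I)⁻¹ with hc₀
  set v : ℕ → ℕ → ℂ := fun i m => c₀ *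
    ∮ z in C(0, r), (∮ ζ in C(0, R), (k ζ)⁻¹ ^ (i + 1) / (ζ - z)) * (deriv k z * k z ^ m) with hv
  set γ : ℕ → ℂ := fun m => c₀ *
    ∮ z in C(0, r), (∮ ζ in C(0, R), k ζ / (ζ - z)) * (deriv k z * k z ^ m) with hγ
  set Φ : ℂ → (ℕ → ℂ) → ℂ → ℂ := fun ε x z => (2 * Real.pi * I)⁻¹ * ∮ ζ in C(0, R),
      (ε * k ζ + (k ζ)⁻¹ * ∑' i, x i * (k ζ)⁻¹ ^ i) / (ζ - z) with hΦ
  obtain ⟨N, hN⟩ := (isCompact_sphere (0 : ℂ) R).exists_bound_of_continuousOn hkR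
  have hpow : ∀ i : ℕ, ∀ ζ ∈ sphere (0 : ℂ) R, ‖(k ζ)⁻¹ ^ i‖ ≤ t ^ i := fun i ζ hζ => by
    rw [norm_pow]
    have := ht ζ hζ
    gcongr
  have hexpand : ∀ (ε : ℂ) (x : ℕ → ℂ) (A : ℝ), (∀ m, ‖x m‖ ≤ A) → ∀ m,
      (2 * Real.pi * I)⁻¹ * (∮ z in C(0, r), Φ ε x z * deriv k z * k z ^ m) =
        ε * γ m + ∑' i, x i * v i m := by
    intro ε x A hx m
    let F : ℕ → ℂ → ℂ := fun i ζ => match i with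
      | 0 => ε * k ζ
      | i + 1 => x i * (k ζ)⁻¹ ^ (i + 1)
    let u : ℕ → ℝ := fun i => match i with
      | 0 => ‖ε‖ * N
      | i + 1 => A * t ^ (i + 1)
    have hu : Summable u := by
      refine (summable_nat_add_iff 1).1 ?_
      exact ((summable_nat_add_iff 1).2 (summable_geometric_of_lt_one ht0.le ht1)).mul_left A
    have hFu : ∀ i, ∀ ζ ∈ sphere (0 : ℂ) R, ‖F i ζ‖ ≤ u i := by
      rintro (_ | i) ζ hζ
      · simp only [F, u, norm_mul]
        exact mul_le_mul_of_nonneg_left (hN ζ hζ) (norm_nonneg _)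
      · simp only [F, u, norm_mul]
        exact mul_le_mul (hx i) (hpow _ ζ hζ) (norm_nonneg _) ((norm_nonneg _).trans (hx i))
    have hF : ∀ i, ContinuousOn (F i) (sphere 0 R) := by
      rintro (_ | i)
      · exact continuousOn_const.mul hkR
      · exact continuousOn_const.mul (hki.pow _)
    have key := hasSum_integral_cauchyTransform_mul hr.le hrR hF hu hFu (hh m)
    have hFsum : ∀ ζ ∈ sphere (0 : ℂ) R, ∑' i, F i ζ =
        ε * k ζ + (k ζ)⁻¹ * ∑' i, x i * (k ζ)⁻¹ ^ i := by
      intro ζ hζ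
      rw [(Summable.of_norm_bounded hu fun i => hFu i ζ hζ).tsum_eq_zero_add, ← tsum_mul_left]
      congr 1
      refine tsum_congr fun i => ?_
      simp only [F]
      ring
    have hlhs : c₀ * (∮ z in C(0, r), (∮ ζ in C(0, R), (∑' i, F i ζ) / (ζ - z)) *
          (deriv k z * k z ^ m)) =
        (2 * Real.pi * I)⁻¹ * (∮ z in C(0, r), Φ ε x z * deriv k z * k z ^ m) := by
      rw [hc₀, mul_assoc, ← circleIntegral.integral_const_mul]
      congr 1
      refine circleIntegral.integral_congr hr.le fun z hz => ?_
      have : (∮ ζ in C(0, R), (∑' i, F i ζ) / (ζ - z)) = ∮ ζ in C(0, R),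
          (ε * k ζ + (k ζ)⁻¹ * ∑' i, x i * (k ζ)⁻¹ ^ i) / (ζ - z) :=
        circleIntegral.integral_congr (hr.trans hrR).le fun ζ hζ => by rw [hFsum ζ hζ]
      simp only [hΦ, this]
      ring
    have key' := key.mul_left c₀
    rw [← hlhs, ← key'.tsum_eq, key'.summable.tsum_eq_zero_add]
    have hmul : ∀ (b : ℂ) (f : ℂ → ℂ),
        c₀ * (∮ z in C(0, r), (∮ ζ in C(0, R), b * f ζ / (ζ - z)) * (deriv k z * k z ^ m)) =
        b * (c₀ * ∮ z in C(0, r), (∮ ζ in C(0, R), f ζ / (ζ - z)) * (deriv k z * k z ^ m)) := by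
      intro b f
      simp_rw [mul_div_assoc, circleIntegral.integral_const_mul, mul_assoc,
        circleIntegral.integral_const_mul]
      ring
    congr 1
    · exact hmul ε k
    · exact tsum_congr fun i => hmul (x i) fun ζ => (k ζ)⁻¹ ^ (i + 1)
  obtain ⟨M, hM⟩ := (isCompact_sphere (0 : ℂ) r).exists_bound_of_continuousOn hkd
  have hbound : ∃ C : ℝ, 0 ≤ C ∧ ∀ (m : ℕ) (f : ℂ → ℂ) (U : ℝ),
      (∀ ζ ∈ sphere (0 : ℂ) R, ‖f ζ‖ ≤ U) →
      ‖c₀ * ∮ z in C(0, r), (∮ ζ in C(0, R), f ζ / (ζ - z)) * (deriv k z * k z ^ m)‖ ≤ C * U := by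
    have hRr : 0 < R - r := sub_pos.2 hrR
    have hR : 0 < R := hr.trans hrR
    refine ⟨‖c₀‖ * (2 * Real.pi * r * (2 * Real.pi * R / (R - r) * |M|)), by positivity,
      fun m f U hf => ?_⟩
    rw [norm_mul, mul_assoc ‖c₀‖]
    refine mul_le_mul_of_nonneg_left ?_ (norm_nonneg _)
    refine (circleIntegral.norm_integral_le_of_norm_le_const hr.le
      (C := 2 * Real.pi * R * (U / (R - r)) * |M|) fun z hz => ?_).trans_eq (by ring)
    have hz' : ‖z‖ = r := by simpa using hz
    have h1 := norm_cauchyTransform_le (by rw [hz']; exact hrR) hf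
    rw [hz'] at h1
    have h2 : ‖deriv k z * k z ^ m‖ ≤ |M| := by
      rw [norm_mul, norm_pow]
      exact (mul_le_of_le_one_right (norm_nonneg _)
        (pow_le_one₀ (norm_nonneg _) ((hs z hz).trans hs1.le))).trans
        ((hM z hz).trans (le_abs_self M))
    rw [norm_mul]
    exact mul_le_mul h1 h2 (norm_nonneg _) ((norm_nonneg _).trans h1)
  obtain ⟨C, hC, hCb⟩ := hbound
  have hvb : ∀ i m, ‖v i m‖ ≤ C * t ^ i := fun i m =>
    hCb m _ _ fun ζ hζ => (hpow (i + 1) ζ hζ).trans (pow_le_pow_of_le_one ht0.le ht1.le i.le_succ)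
  obtain ⟨x, A, hx, hxeq⟩ := exists_bounded_solution_of_unique ht0.le ht1 hvb
    (fun x A hx hxeq m => by
      have hmom : ∀ m : ℕ, x m =
          (2 * Real.pi * I)⁻¹ * ∮ z in C(0, r), Φ 0 x z * deriv k z * k z ^ m := fun m => by
        rw [hexpand 0 x A hx m, zero_mul, zero_add]
        exact hxeq m
      obtain ⟨h1, h2, h3⟩ := hk.eq_of_moments (φ := Φ 0 x) hr₀ hr1 hR1 hR₀ hx (fun z => rfl) hmom
      obtain ⟨c, hc1, hc2⟩ := hk.constant_of_eq_comp_inv h1 (analyticOnNhd_id.mul h2)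
        fun z hz => by rw [h3 z hz, zero_mul, zero_add]
      have hc : c = 0 := by rw [← hc2 0 (by simp)]; simp
      have hzero : ∀ z ∈ sphere (0 : ℂ) r, Φ 0 x z * deriv k z * k z ^ m = 0 := fun z hz => by
        rw [hc1 z (by rw [mem_sphere_zero_iff_norm.1 hz]; exact hr1.le), hc, zero_mul, zero_mul]
      rw [hmom m, circleIntegral.integral_congr hr.le hzero]
      simp [circleIntegral])
    (γ := γ) (A := C * N) fun m => hCb m k N hN
  have hmom : ∀ m : ℕ, x m =
      (2 * Real.pi * I)⁻¹ * ∮ z in C(0, r), Φ 1 x z * deriv k z * k z ^ m := fun m => by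
    rw [hexpand 1 x A hx m, one_mul]
    exact hxeq m
  obtain ⟨h1, h2, h3⟩ := hk.eq_of_moments (φ := Φ 1 x) hr₀ hr1 hR1 hR₀ hx (fun z => rfl) hmom
  exact ⟨Φ 1 x, fun ω => ω * ∑' i, x i * ω ^ i, h1, analyticOnNhd_id.mul h2, fun z hz => by
    rw [h3 z hz, one_mul]⟩

end WeldingMap

/-- The principal part at `0` of a meromorphic function with a pole of order at most `m` is matched
by a polynomial in any function of the form `1 / ω + G ω`. -/
lemma exists_polynomial_eval_add {G : ℂ → ℂ} (hG : AnalyticOnNhd ℂ G (closedBall 0 1)) (m : ℕ)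
    {A : ℂ → ℂ} (hA : AnalyticOnNhd ℂ A (closedBall 0 1)) :
    ∃ (Q : ℂ[X]) (H : ℂ → ℂ), Q.natDegree ≤ m ∧ Q.coeff m = A 0 ∧
      AnalyticOnNhd ℂ H (closedBall 0 1) ∧
      ∀ ω, ω ≠ 0 → A ω * ω⁻¹ ^ m = Q.eval (ω⁻¹ + G ω) + H ω := by
  induction m generalizing A with
  | zero =>
    exact ⟨C (A 0), fun ω => A ω - A 0, by simp, by simp, hA.sub analyticOnNhd_const,
      fun ω _ => by simp⟩
  | succ m ih =>
    set D : ℂ → ℂ := fun ω => A ω - A 0 * (1 + ω * G ω) ^ (m + 1) with hD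
    have hDan : AnalyticOnNhd ℂ D (closedBall 0 1) :=
      hA.sub (analyticOnNhd_const.mul ((analyticOnNhd_const.add (analyticOnNhd_id.mul hG)).pow _))
    have hD0 : D 0 = 0 := by simp [hD]
    obtain ⟨Q, H, hQ1, -, hH, heq⟩ := ih (A := dslope D 0) fun ω hω =>
      analyticAt_dslope (hDan 0 (by simp)) (hDan ω hω)
    refine ⟨C (A 0) * X ^ (m + 1) + Q, H, ?_, ?_, hH, fun ω hω => ?_⟩
    · refine (natDegree_add_le _ _).trans (max_le (natDegree_C_mul_X_pow_le _ _) (by omega))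
    · rw [coeff_add, coeff_C_mul_X_pow, if_pos rfl, coeff_eq_zero_of_natDegree_lt (by omega),
        add_zero]
    · have h1 := heq ω hω
      have h2 : D ω = ω * dslope D 0 ω := by
        rw [dslope_of_ne _ hω, slope_def_field, hD0, sub_zero, sub_zero]
        field_simp
      have h3 : (ω⁻¹ + G ω) ^ (m + 1) = (1 + ω * G ω) ^ (m + 1) * ω⁻¹ ^ (m + 1) := by
        rw [← mul_pow]
        congr 1
        field_simp
      have h4 : A ω = ω * dslope D 0 ω + A 0 * (1 + ω * G ω) ^ (m + 1) := by
        rw [← h2, hD]; ring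
      rw [eval_add, eval_mul, eval_C, eval_pow, eval_X, add_assoc, ← h1, h3]
      conv_lhs => rw [h4]
      rw [pow_succ ω⁻¹]
      field_simp
      ring

lemma WeldingMap.exists_polynomial {k : ℂ → ℂ} {r₀ R₀ : ℝ} (hk : WeldingMap k r₀ R₀)
    {φ G B : ℂ → ℂ} (hφ : AnalyticOnNhd ℂ φ (closedBall 0 1))
    (hG : AnalyticOnNhd ℂ G (closedBall 0 1)) (hB : AnalyticOnNhd ℂ B (closedBall 0 1))
    (hφG : ∀ z, ‖z‖ = 1 → φ z = k z + G (k z)⁻¹) {n : ℕ} (hn : n ≠ 0)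
    (hkB : ∀ z, ‖z‖ = 1 → k z ^ n = B z) :
    ∃ P : ℂ[X], P.natDegree = n ∧ P.Monic ∧ (∀ z, ‖z‖ ≤ 1 → P.eval (φ z) = B z) ∧
      ∀ w, 1 ≤ ‖w‖ → P.eval (w + G w⁻¹) = w ^ n := by
  obtain ⟨Q, H, hQ1, hQ2, hH, heq⟩ := exists_polynomial_eval_add hG n
    (A := fun _ => 1) analyticOnNhd_const
  have hev : ∀ w, w ≠ 0 → Q.eval (w + G w⁻¹) = w ^ n - H w⁻¹ := fun w hw => by
    have := heq w⁻¹ (inv_ne_zero hw)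
    rw [inv_inv, one_mul] at this
    rw [this]; ring
  obtain ⟨c, hc1, hc2⟩ := hk.constant_of_eq_comp_inv (u := fun z => B z - Q.eval (φ z)) (v := H)
    (fun z hz => (hB z hz).sub
      ((AnalyticOnNhd.eval_polynomial Q (φ z) trivial).comp (hφ z hz))) hH
    (fun z hz => by
      have hkz : k z ≠ 0 := by rw [← norm_pos_iff, hk.norm_eq z hz]; exact one_pos
      rw [hφG z hz, hev _ hkz, hkB z hz]; ring)
  have hcoeff : (Q + C c).coeff n = 1 := by
    rw [coeff_add, coeff_C_of_ne_zero hn, add_zero]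
    exact hQ2
  have hdeg : (Q + C c).natDegree = n := by
    refine le_antisymm ?_ (le_natDegree_of_ne_zero (by rw [hcoeff]; exact one_ne_zero))
    rw [natDegree_add_C]
    exact hQ1
  refine ⟨Q + C c, hdeg, ?_, fun z hz => ?_, fun w hw => ?_⟩
  · rw [Monic, leadingCoeff, hdeg, hcoeff]
  · rw [eval_add, eval_C, ← hc1 z hz]; ring
  · have hw0 : w ≠ 0 := by rw [← norm_pos_iff]; linarith
    rw [eval_add, eval_C, hev w hw0, hc2 _ (by rw [norm_inv]; exact inv_le_one_of_one_le₀ hw)]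
    ring

lemma sub_C_ne_zero_of_natDegree_pos {P : ℂ[X]} (hP : 0 < P.natDegree) (ζ : ℂ) : P - C ζ ≠ 0 :=
  ne_zero_of_natDegree_gt (n := 0) (by rwa [natDegree_sub_C])

lemma card_roots_toFinset_of_derivative_ne_zero {P : ℂ[X]} (hP : 0 < P.natDegree) {ζ : ℂ}
    (h : ∀ y, P.eval y = ζ → P.derivative.eval y ≠ 0) :
    (P - C ζ).roots.toFinset.card = P.natDegree := by
  have hne := sub_C_ne_zero_of_natDegree_pos hP ζ
  have hnodup : (P - C ζ).roots.Nodup := by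
    rw [Multiset.nodup_iff_count_le_one]
    intro y
    rw [count_roots]
    by_contra! hlt
    obtain ⟨h1, h2⟩ := (one_lt_rootMultiplicity_iff_isRoot hne).1 hlt
    simp only [IsRoot.def, eval_sub, eval_C, sub_eq_zero, derivative_sub, derivative_C,
      sub_zero] at h1 h2
    exact h y h1 h2
  rw [Multiset.toFinset_card_of_nodup hnodup, IsAlgClosed.card_roots_eq_natDegree, natDegree_sub_C]

/-- A map from at most `deg P` points onto the fibre of `P` over a regular value is injective. -/
lemma injOn_of_surjOn_fibre {P : ℂ[X]} (hP : 0 < P.natDegree) {ζ : ℂ}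
    (h : ∀ y, P.eval y = ζ → P.derivative.eval y ≠ 0) {f : ℂ → ℂ} {Z : Finset ℂ}
    (hZ : Z.card ≤ P.natDegree) (hf : ∀ y, P.eval y = ζ → ∃ z ∈ Z, f z = y) : InjOn f Z := by
  have hne := sub_C_ne_zero_of_natDegree_pos hP ζ
  have hsub : (P - C ζ).roots.toFinset ⊆ Z.image f := fun y hy => by
    rw [Multiset.mem_toFinset, mem_roots hne, IsRoot.def, eval_sub, eval_C, sub_eq_zero] at hy
    exact Finset.mem_image.2 (hf y hy)
  have h1 := Finset.card_le_card hsub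
  rw [card_roots_toFinset_of_derivative_ne_zero hP h] at h1
  exact Finset.card_image_iff.1 (le_antisymm Finset.card_image_le (hZ.trans h1))

lemma finite_setOf_eval_eq_critical_value {P : ℂ[X]} (hP : 0 < P.natDegree) :
    {y : ℂ | ∃ c, P.derivative.eval c = 0 ∧ P.eval c = P.eval y}.Finite := by
  have hd : P.derivative ≠ 0 := fun h => by
    have := derivative_eq_zero.1 h
    omega
  have hne := sub_C_ne_zero_of_natDegree_pos hP
  refine (P.derivative.roots.toFinset.finite_toSet.biUnion
    (t := fun c => ((P - C (P.eval c)).roots.toFinset : Set ℂ))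
    fun c _ => Finset.finite_toSet _).subset ?_
  rintro y ⟨c, hc1, hc2⟩
  simp only [mem_iUnion, Finset.mem_coe, Multiset.mem_toFinset, mem_roots hd, mem_roots (hne _),
    IsRoot.def, eval_sub, eval_C, sub_eq_zero]
  exact ⟨c, hc1, hc2.symm⟩

lemma analyticAt_add_comp_inv {G : ℂ → ℂ} (hG : AnalyticOnNhd ℂ G (closedBall 0 1)) {w : ℂ}
    (hw : 1 ≤ ‖w‖) : AnalyticAt ℂ (fun w => w + G w⁻¹) w := by
  have hw0 : w ≠ 0 := by rw [← norm_pos_iff]; linarith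
  refine analyticAt_id.add (AnalyticAt.comp (hG _ ?_) (analyticAt_inv hw0))
  rw [mem_closedBall_zero_iff, norm_inv]
  exact inv_le_one_of_one_le₀ hw

lemma frequently_one_lt_norm {w : ℂ} (hw : 1 ≤ ‖w‖) : ∃ᶠ v in nhdsWithin w {w}ᶜ, 1 < ‖v‖ := by
  have hw0 : w ≠ 0 := by rw [← norm_pos_iff]; linarith
  have ht : Filter.Tendsto (fun t : ℝ => (t : ℂ) * w) (nhdsWithin 1 (Ioi 1))
      (nhdsWithin w {w}ᶜ) := by
    refine tendsto_nhdsWithin_iff.2 ⟨?_, ?_⟩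
    · have : Continuous fun t : ℝ => (t : ℂ) * w := by fun_prop
      simpa using (this.tendsto 1).mono_left nhdsWithin_le_nhds
    · filter_upwards [self_mem_nhdsWithin] with t (h : 1 < t) heq
      have : (t : ℂ) = 1 := mul_right_cancel₀ hw0 (by rw [one_mul]; exact heq)
      exact h.ne' (by exact_mod_cast this)
  refine ht.frequently (Filter.Eventually.frequently ?_)
  filter_upwards [self_mem_nhdsWithin] with t (h : 1 < t)
  rw [norm_mul, norm_real, Real.norm_eq_abs, abs_of_pos (by linarith)]
  nlinarith

lemma frequently_norm_eq_one {z : ℂ} (hz : ‖z‖ = 1) : ∃ᶠ v in nhdsWithin z {z}ᶜ, ‖v‖ = 1 := by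
  have hz0 : z ≠ 0 := by rw [← norm_pos_iff]; linarith
  have ht : Filter.Tendsto (fun t : ℝ => exp (t * I) * z) (nhdsWithin 0 (Ioo 0 1))
      (nhdsWithin z {z}ᶜ) := by
    refine tendsto_nhdsWithin_iff.2 ⟨?_, ?_⟩
    · have : Continuous fun t : ℝ => exp (t * I) * z := by fun_prop
      simpa using (this.tendsto 0).mono_left nhdsWithin_le_nhds
    · filter_upwards [self_mem_nhdsWithin] with t h heq
      have h1 : exp (t * I) = 1 := mul_right_cancel₀ hz0 (by rw [one_mul]; exact heq)
      obtain ⟨m, hm⟩ := Complex.exp_eq_one_iff.1 h1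
      have h2 : t = m * (2 * Real.pi) := by
        have := congrArg Complex.im hm
        simpa using this
      have hpi := Real.pi_gt_three
      have h3 : (0 : ℝ) < m := by nlinarith [h.1]
      have h4 : (1 : ℝ) ≤ m := by
        have h5 : 0 < m := by exact_mod_cast h3
        exact_mod_cast h5
      nlinarith [h.2]
  have : (nhdsWithin (0 : ℝ) (Ioo 0 1)).NeBot := by
    rw [← mem_closure_iff_nhdsWithin_neBot, closure_Ioo zero_ne_one]
    exact ⟨le_rfl, zero_le_one⟩
  refine ht.frequently (Filter.Eventually.frequently (.of_forall fun t => ?_))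
  rw [norm_mul, norm_exp_ofReal_mul_I, hz, one_mul]

lemma derivative_eval_mul_deriv {P : ℂ[X]} {n : ℕ} {G : ℂ → ℂ}
    (hG : AnalyticOnNhd ℂ G (closedBall 0 1))
    (hP : ∀ w, 1 ≤ ‖w‖ → P.eval (w + G w⁻¹) = w ^ n) {w : ℂ} (hw : 1 ≤ ‖w‖) :
    P.derivative.eval (w + G w⁻¹) * deriv (fun w => w + G w⁻¹) w = n * w ^ (n - 1) := by
  have han := analyticAt_add_comp_inv hG hw
  have hcomp : AnalyticAt ℂ (fun w => P.eval (w + G w⁻¹)) w :=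
    (AnalyticOnNhd.eval_polynomial P _ trivial).comp han
  have hev : (fun w => P.eval (w + G w⁻¹)) =ᶠ[nhds w] fun w => w ^ n :=
    (hcomp.frequently_eq_iff_eventually_eq (analyticAt_id.pow n)).1
      ((frequently_one_lt_norm hw).mono fun v hv => hP v hv.le)
  have h1 : HasDerivAt (fun w => P.eval (w + G w⁻¹))
      (P.derivative.eval (w + G w⁻¹) * deriv (fun w => w + G w⁻¹) w) w :=
    (P.hasDerivAt _).comp w han.differentiableAt.hasDerivAt
  exact h1.unique ((hasDerivAt_pow n w).congr_of_eventuallyEq hev)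

lemma isClosed_image_add_comp_inv {G : ℂ → ℂ} (hG : AnalyticOnNhd ℂ G (closedBall 0 1)) :
    IsClosed ((fun w => w + G w⁻¹) '' {w | 1 ≤ ‖w‖}) := by
  obtain ⟨M, hM⟩ := (isCompact_closedBall (0 : ℂ) 1).exists_bound_of_continuousOn hG.continuousOn
  refine isClosed_of_closure_subset fun y hy => ?_
  set K : Set ℂ := closedBall 0 (M + ‖y‖ + 1) ∩ {w | 1 ≤ ‖w‖}
  have hK : IsCompact ((fun w => w + G w⁻¹) '' K) := by
    refine ((isCompact_closedBall _ _).inter_right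
      (isClosed_le continuous_const continuous_norm)).image_of_continuousOn fun w hw => ?_
    exact (analyticAt_add_comp_inv hG hw.2).continuousAt.continuousWithinAt
  by_contra hy'
  have hyK : y ∉ (fun w => w + G w⁻¹) '' K := fun h => hy' (image_mono inter_subset_right h)
  obtain ⟨_, ⟨h1, h2⟩, w, hw, rfl⟩ := mem_closure_iff_nhds.1 hy _
    (Filter.inter_mem (hK.isClosed.isOpen_compl.mem_nhds hyK) (ball_mem_nhds y one_pos))
  refine h1 ⟨w, ⟨?_, hw⟩, rfl⟩
  have h3 : ‖G w⁻¹‖ ≤ M := hM _ (by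
    rw [mem_closedBall_zero_iff, norm_inv]; exact inv_le_one_of_one_le₀ hw)
  have h4 : ‖w + G w⁻¹ - y‖ < 1 := by simpa [dist_eq_norm] using h2
  rw [mem_closedBall_zero_iff]
  calc ‖w‖ = ‖(w + G w⁻¹ - y) + y - G w⁻¹‖ := by congr 1; ring
    _ ≤ ‖w + G w⁻¹ - y‖ + ‖y‖ + ‖G w⁻¹‖ :=
      (norm_sub_le _ _).trans (add_le_add_left (norm_add_le _ _) _)
    _ ≤ M + ‖y‖ + 1 := by linarith

/-- Data for a polynomial lemniscate: `φ` and `w ↦ w + G (1 / w)` conjugate the polynomial `P` to `B`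
on the unit disk and to `w ↦ w ^ n` on its exterior, and they are matched by the welding map `k`. -/
structure LemniscateData (k φ G B : ℂ → ℂ) (r₀ R₀ : ℝ) (n : ℕ) (P : ℂ[X]) : Prop where
  welding : WeldingMap k r₀ R₀
  analytic_int : AnalyticOnNhd ℂ φ (closedBall 0 1)
  analytic_ext : AnalyticOnNhd ℂ G (closedBall 0 1)
  matching : ∀ z, ‖z‖ = 1 → φ z = k z + G (k z)⁻¹
  natDegree_pos : 0 < n
  natDegree_eq : P.natDegree = n
  eval_int : ∀ z, ‖z‖ ≤ 1 → P.eval (φ z) = B z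
  eval_ext : ∀ w, 1 ≤ ‖w‖ → P.eval (w + G w⁻¹) = w ^ n
  norm_lt : ∀ z, ‖z‖ < 1 → ‖B z‖ < 1
  norm_eq : ∀ z, ‖z‖ = 1 → ‖B z‖ = 1
  fibre : ∀ ζ : ℂ, ∃ Z : Finset ℂ, Z.card ≤ n ∧ ∀ z, ‖z‖ < 1 → B z = ζ → z ∈ Z

namespace LemniscateData

variable {k φ G B : ℂ → ℂ} {r₀ R₀ : ℝ} {n : ℕ} {P : ℂ[X]}

lemma deriv_ext_ne_zero (h : LemniscateData k φ G B r₀ R₀ n P) {w : ℂ} (hw : 1 ≤ ‖w‖) :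
    P.derivative.eval (w + G w⁻¹) ≠ 0 ∧ deriv (fun w => w + G w⁻¹) w ≠ 0 := by
  have hw0 : w ≠ 0 := by rw [← norm_pos_iff]; linarith
  have hd := derivative_eval_mul_deriv h.analytic_ext h.eval_ext hw
  have hne : (n : ℂ) * w ^ (n - 1) ≠ 0 :=
    mul_ne_zero (by exact_mod_cast h.natDegree_pos.ne') (pow_ne_zero _ hw0)
  rw [← hd] at hne
  exact ⟨left_ne_zero_of_mul hne, right_ne_zero_of_mul hne⟩

lemma nhds_le_map (h : LemniscateData k φ G B r₀ R₀ n P) {z : ℂ} (hz : ‖z‖ ≤ 1) :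
    nhds (φ z) ≤ Filter.map φ (nhds z) := by
  refine (h.analytic_int z (by simpa using hz)).eventually_constant_or_nhds_le_map_nhds.resolve_left
    fun hc => ?_
  have heq := h.analytic_int.eqOn_of_preconnected_of_eventuallyEq analyticOnNhd_const
    (convex_closedBall 0 1).isPreconnected (by simpa using hz) hc
  have h0 := h.eval_int 0 (by simp)
  have h1 := h.eval_int 1 (by simp)
  rw [heq (by simp)] at h0 h1
  have h2 := h.norm_lt 0 (by simp)
  rw [← h0, h1, h.norm_eq 1 (by simp)] at h2
  exact lt_irrefl _ h2

lemma eventually_eq_comp (h : LemniscateData k φ G B r₀ R₀ n P) {z : ℂ} (hz : ‖z‖ = 1) :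
    ∀ᶠ y in nhds z, φ y = k y + G (k y)⁻¹ := by
  have hkz : AnalyticAt ℂ k z := h.welding.analyticAt z (by linarith [h.welding.r₀_lt])
    (by linarith [h.welding.lt_R₀])
  have hcomp : AnalyticAt ℂ (fun y => k y + G (k y)⁻¹) z :=
    (analyticAt_add_comp_inv h.analytic_ext (h.welding.norm_eq z hz).ge).comp hkz
  exact ((h.analytic_int z (by simp [hz])).frequently_eq_iff_eventually_eq hcomp).1
    ((frequently_norm_eq_one hz).mono fun y hy => h.matching y hy)

/-- The closed disk and the closed exterior together cover the plane. -/
lemma union_eq_univ (h : LemniscateData k φ G B r₀ R₀ n P) :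
    φ '' closedBall 0 1 ∪ (fun w => w + G w⁻¹) '' {w | 1 ≤ ‖w‖} = univ := by
  refine IsClopen.eq_univ ⟨?_, ?_⟩ ⟨φ 0, .inl ⟨0, by simp, rfl⟩⟩
  · exact ((isCompact_closedBall _ _).image_of_continuousOn
      h.analytic_int.continuousOn).isClosed.union (isClosed_image_add_comp_inv h.analytic_ext)
  · have hT : ∀ z, ‖z‖ = 1 →
        φ '' closedBall 0 1 ∪ (fun w => w + G w⁻¹) '' {w | 1 ≤ ‖w‖} ∈ nhds (φ z) := by
      intro z hz
      refine h.nhds_le_map hz.le (Filter.mem_map.2 ?_)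
      have hR : ∀ᶠ y : ℂ in nhds z, ‖y‖ < R₀ := continuous_norm.continuousAt.eventually
        (gt_mem_nhds (by simpa only [hz] using h.welding.lt_R₀))
      filter_upwards [h.eventually_eq_comp hz, hR] with y hy1 hy2
      rcases le_or_gt ‖y‖ 1 with hy | hy
      · exact .inl ⟨y, by simpa using hy, rfl⟩
      · exact .inr ⟨k y, (h.welding.lt_norm y hy hy2).le, hy1.symm⟩
    rw [isOpen_iff_mem_nhds]
    rintro _ (⟨z, hz, rfl⟩ | ⟨w, hw, rfl⟩)
    · rcases (mem_closedBall_zero_iff.1 hz).lt_or_eq with hz' | hz'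
      · refine h.nhds_le_map hz'.le (Filter.mem_map.2 ?_)
        filter_upwards [isOpen_ball.mem_nhds (mem_ball_zero_iff.2 hz')] with y hy
        exact .inl ⟨y, ball_subset_closedBall hy, rfl⟩
      · exact hT z hz'
    · rcases (show 1 ≤ ‖w‖ from hw).lt_or_eq with hw' | hw'
      · have hs := (analyticAt_add_comp_inv h.analytic_ext hw).hasStrictDerivAt
        rw [← hs.map_nhds_eq (h.deriv_ext_ne_zero hw).2]
        refine Filter.mem_map.2 ?_
        filter_upwards [continuous_norm.continuousAt.eventually (lt_mem_nhds hw')] with v hv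
        exact .inr ⟨v, hv.le, rfl⟩
      · obtain ⟨z, hz, rfl⟩ := h.welding.surjOn (mem_sphere_zero_iff_norm.2 hw'.symm)
        have hz' : ‖z‖ = 1 := by simpa using hz
        simp only
        rw [← h.matching z hz']
        exact hT z hz'

lemma exists_ext (h : LemniscateData k φ G B r₀ R₀ n P) {y : ℂ} (hy : 1 ≤ ‖P.eval y‖) :
    ∃ w, 1 ≤ ‖w‖ ∧ w + G w⁻¹ = y := by
  rcases h.union_eq_univ.ge (mem_univ y) with ⟨z, hz, rfl⟩ | ⟨w, hw, rfl⟩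
  · rw [mem_closedBall_zero_iff] at hz
    rw [h.eval_int z hz] at hy
    have hz1 : ‖z‖ = 1 := le_antisymm hz (not_lt.1 fun hlt => (h.norm_lt z hlt).not_ge hy)
    exact ⟨k z, (h.welding.norm_eq z hz1).ge, (h.matching z hz1).symm⟩
  · exact ⟨w, hw, rfl⟩

lemma exists_int (h : LemniscateData k φ G B r₀ R₀ n P) {y : ℂ} (hy : ‖P.eval y‖ < 1) :
    ∃ z, ‖z‖ < 1 ∧ φ z = y := by
  rcases h.union_eq_univ.ge (mem_univ y) with ⟨z, hz, rfl⟩ | ⟨w, hw, rfl⟩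
  · rw [mem_closedBall_zero_iff] at hz
    rw [h.eval_int z hz] at hy
    exact ⟨z, hz.lt_of_ne fun hz1 => hy.ne (h.norm_eq z hz1), rfl⟩
  · rw [h.eval_ext w hw, norm_pow] at hy
    exact absurd hy (one_le_pow₀ hw).not_gt

lemma derivative_ne_zero (h : LemniscateData k φ G B r₀ R₀ n P) {y : ℂ} (hy : 1 ≤ ‖P.eval y‖) :
    P.derivative.eval y ≠ 0 := by
  obtain ⟨w, hw, rfl⟩ := h.exists_ext hy
  exact (h.deriv_ext_ne_zero hw).1

lemma injOn_ext (h : LemniscateData k φ G B r₀ R₀ n P) :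
    InjOn (fun w => w + G w⁻¹) {w | 1 ≤ ‖w‖} := by
  intro v hv w hw hvw
  have hvn := h.eval_ext v hv
  have hwn := h.eval_ext w hw
  simp only at hvw
  rw [hvw] at hvn
  have hζ : 1 ≤ ‖w ^ n‖ := by rw [norm_pow]; exact one_le_pow₀ hw
  have hinj := injOn_of_surjOn_fibre (P := P) (ζ := w ^ n) (f := fun w => w + G w⁻¹)
    (Z := (nthRoots n (w ^ n)).toFinset) (by rw [h.natDegree_eq]; exact h.natDegree_pos)
    (fun y hy => h.derivative_ne_zero (by rw [hy]; exact hζ))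
    (by rw [h.natDegree_eq]; exact (Multiset.toFinset_card_le _).trans (card_nthRoots n _))
    fun y hy => by
      obtain ⟨u, hu, rfl⟩ := h.exists_ext (y := y) (by rw [hy]; exact hζ)
      refine ⟨u, ?_, rfl⟩
      rw [Multiset.mem_toFinset, mem_nthRoots h.natDegree_pos, ← hy, h.eval_ext u hu]
  refine hinj ?_ ?_ hvw <;> rw [Finset.mem_coe, Multiset.mem_toFinset, mem_nthRoots h.natDegree_pos]
  rw [← hvn, hwn]

lemma injOn_int (h : LemniscateData k φ G B r₀ R₀ n P) : InjOn φ (closedBall 0 1) := by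
  have hP : 0 < P.natDegree := by rw [h.natDegree_eq]; exact h.natDegree_pos
  have hball : InjOn φ (ball 0 1) := by
    intro p hp q hq hpq
    by_contra hne
    obtain ⟨U, V, hU, hV, hpU, hqV, hUV⟩ := t2_separation hne
    have hnhds : ∀ z ∈ ball (0 : ℂ) 1, ∀ W ∈ nhds z, φ '' (W ∩ ball 0 1) ∈ nhds (φ z) :=
      fun z hz W hW => h.nhds_le_map (mem_ball_zero_iff.1 hz).le
        (Filter.image_mem_map (Filter.inter_mem hW (isOpen_ball.mem_nhds hz)))
    have hmem := Filter.inter_mem (hnhds p hp U (hU.mem_nhds hpU))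
      (hpq ▸ hnhds q hq V (hV.mem_nhds hqV))
    obtain ⟨y, ⟨⟨p', hp', hpy⟩, q', hq', hqy⟩, hy⟩ :=
      ((infinite_of_mem_nhds _ hmem).sdiff (finite_setOf_eval_eq_critical_value hP)).nonempty
    have hBp := h.eval_int p' (mem_ball_zero_iff.1 hp'.2).le
    have hBq := h.eval_int q' (mem_ball_zero_iff.1 hq'.2).le
    rw [hpy] at hBp
    rw [hqy] at hBq
    have hζ : ‖P.eval y‖ < 1 := by rw [hBp]; exact h.norm_lt p' (mem_ball_zero_iff.1 hp'.2)
    obtain ⟨Z, hZ1, hZ2⟩ := h.fibre (P.eval y)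
    have hinj := injOn_of_surjOn_fibre (P := P) (ζ := P.eval y) (f := φ) (Z := Z) hP
      (fun c hc hc' => hy ⟨c, hc', hc⟩) (by rw [h.natDegree_eq]; exact hZ1) fun c hc => by
        obtain ⟨z, hz, rfl⟩ := h.exists_int (y := c) (by rw [hc]; exact hζ)
        exact ⟨z, hZ2 z hz (by rw [← hc, h.eval_int z hz.le]), rfl⟩
    have := hinj (hZ2 p' (mem_ball_zero_iff.1 hp'.2) hBp.symm)
      (hZ2 q' (mem_ball_zero_iff.1 hq'.2) hBq.symm) (hpy.trans hqy.symm)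
    subst this
    exact hUV.le_bot ⟨hp'.1, hq'.1⟩
  intro p hp q hq hpq
  rw [mem_closedBall_zero_iff] at hp hq
  have hB : B p = B q := by rw [← h.eval_int p hp, ← h.eval_int q hq, hpq]
  rcases hp.lt_or_eq with hp' | hp' <;> rcases hq.lt_or_eq with hq' | hq'
  · exact hball (by simpa using hp') (by simpa using hq') hpq
  · have := h.norm_lt p hp'
    rw [hB, h.norm_eq q hq'] at this
    exact absurd this (lt_irrefl _)
  · have := h.norm_lt q hq'
    rw [← hB, h.norm_eq p hp'] at this
    exact absurd this (lt_irrefl _)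
  · refine h.welding.injOn (by simpa using hp') (by simpa using hq') ?_
    refine h.injOn_ext (h.welding.norm_eq p hp').ge (h.welding.norm_eq q hq').ge ?_
    simp only
    rw [← h.matching p hp', ← h.matching q hq', hpq]

lemma image_sphere_ext (h : LemniscateData k φ G B r₀ R₀ n P) :
    (fun w => w + G w⁻¹) '' sphere 0 1 = {z | ‖P.eval z‖ = 1} := by
  ext y
  constructor
  · rintro ⟨w, hw, rfl⟩
    rw [mem_sphere_zero_iff_norm] at hw
    rw [mem_ofPred_eq, h.eval_ext w hw.ge, norm_pow, hw, one_pow]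
  · intro hy
    obtain ⟨w, hw, rfl⟩ := h.exists_ext (y := y) (ge_of_eq hy)
    rw [mem_ofPred_eq, h.eval_ext w hw, norm_pow] at hy
    exact ⟨w, by simpa using (pow_eq_one_iff_of_nonneg (norm_nonneg w) h.natDegree_pos.ne').1 hy,
      rfl⟩

lemma image_sphere_int (h : LemniscateData k φ G B r₀ R₀ n P) :
    φ '' sphere 0 1 = {z | ‖P.eval z‖ = 1} := by
  rw [← h.image_sphere_ext]
  ext y
  constructor
  · rintro ⟨z, hz, rfl⟩
    rw [mem_sphere_zero_iff_norm] at hz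
    exact ⟨k z, by simpa using h.welding.norm_eq z hz, (h.matching z hz).symm⟩
  · rintro ⟨w, hw, rfl⟩
    obtain ⟨z, hz, rfl⟩ := h.welding.surjOn hw
    exact ⟨z, hz, h.matching z (by simpa using hz)⟩

lemma image_ball_int (h : LemniscateData k φ G B r₀ R₀ n P) :
    φ '' ball 0 1 = {z | ‖P.eval z‖ < 1} := by
  ext y
  constructor
  · rintro ⟨z, hz, rfl⟩
    rw [mem_ball_zero_iff] at hz
    rw [mem_ofPred_eq, h.eval_int z hz.le]
    exact h.norm_lt z hz
  · intro hy
    obtain ⟨z, hz, rfl⟩ := h.exists_int hy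
    exact ⟨z, by simpa using hz, rfl⟩

lemma image_ext (h : LemniscateData k φ G B r₀ R₀ n P) :
    (fun w => w + G w⁻¹) '' {w | 1 < ‖w‖} = {z | 1 < ‖P.eval z‖} := by
  ext y
  constructor
  · rintro ⟨w, hw, rfl⟩
    rw [mem_ofPred_eq] at hw
    rw [mem_ofPred_eq, h.eval_ext w hw.le, norm_pow]
    exact one_lt_pow₀ hw h.natDegree_pos.ne'
  · intro hy
    rw [mem_ofPred_eq] at hy
    obtain ⟨w, hw, rfl⟩ := h.exists_ext hy.le
    rw [h.eval_ext w hw, norm_pow] at hy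
    refine ⟨w, hw.lt_of_ne fun h1 => ?_, rfl⟩
    rw [← h1, one_pow] at hy
    exact lt_irrefl _ hy

theorem conformalPair (h : LemniscateData k φ G B r₀ R₀ n P) :
    ConformalPair {z | ‖P.eval z‖ = 1} φ fun w => w + G w⁻¹ where
  contm := h.analytic_int.continuousOn
  injm := h.injOn_int
  holm := (h.analytic_int.mono ball_subset_closedBall).differentiableOn
  mapm := h.image_sphere_int
  contp := fun w hw => (analyticAt_add_comp_inv h.analytic_ext hw).continuousAt.continuousWithinAt
  injp := h.injOn_ext
  holp := fun w hw => (analyticAt_add_comp_inv h.analytic_ext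
    (le_of_lt hw)).differentiableAt.differentiableWithinAt
  mapp := h.image_sphere_ext
  deriv_infty := by
    refine ⟨1, one_pos, ?_⟩
    have hinv : Filter.Tendsto (fun w : ℂ => w⁻¹) (Bornology.cobounded ℂ) (nhds 0) :=
      Filter.tendsto_inv₀_cobounded
    have hG := (h.analytic_ext 0 (by simp)).continuousAt.tendsto.comp hinv
    have hlim := (hG.mul hinv).const_add 1
    rw [mul_zero, add_zero] at hlim
    rw [ofReal_one]
    refine hlim.congr' ?_
    have hne : ∀ᶠ w : ℂ in Bornology.cobounded ℂ, w ≠ 0 := Bornology.eventually_ne_cobounded 0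
    filter_upwards [hne] with w hw
    simp only [Function.comp_apply]
    field_simp
  disj_mp := by
    rw [h.image_ball_int, h.image_ext, Set.disjoint_left]
    intro y (h1 : ‖P.eval y‖ < 1) (h2 : 1 < ‖P.eval y‖)
    linarith
  disj_mG := by
    rw [h.image_ball_int, Set.disjoint_left]
    intro y (h1 : ‖P.eval y‖ < 1) (h2 : ‖P.eval y‖ = 1)
    linarith
  disj_pG := by
    rw [h.image_ext, Set.disjoint_left]
    intro y (h1 : 1 < ‖P.eval y‖) (h2 : ‖P.eval y‖ = 1)
    linarith
  union_eq := by
    rw [h.image_ball_int, h.image_ext, eq_univ_iff_forall]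
    intro y
    rcases lt_trichotomy ‖P.eval y‖ 1 with h1 | h1 | h1
    · exact .inl (.inl h1)
    · exact .inl (.inr h1)
    · exact .inr h1

end LemniscateData

/-- A map of the form `μ z exp (ℓ z)` is a welding map as soon as it separates the two sides of the
unit circle and its angular derivative is positive. -/
theorem weldingMap_of_exp {ℓ : ℂ → ℂ} {μ : ℂ} {r₀ R₀ : ℝ} (h0 : 0 < r₀) (h1 : r₀ < 1) (h2 : 1 < R₀)
    (hμ : ‖μ‖ = 1) (hℓ : ∀ z, r₀ < ‖z‖ → ‖z‖ < R₀ → AnalyticAt ℂ ℓ z)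
    (hlt : ∀ z, r₀ < ‖z‖ → ‖z‖ < 1 → ‖μ * z * exp (ℓ z)‖ < 1)
    (heq : ∀ z, ‖z‖ = 1 → ‖μ * z * exp (ℓ z)‖ = 1)
    (hgt : ∀ z, 1 < ‖z‖ → ‖z‖ < R₀ → 1 < ‖μ * z * exp (ℓ z)‖)
    (hpos : ∀ z, ‖z‖ = 1 → 0 < (1 + z * deriv ℓ z).re) :
    WeldingMap (fun z => μ * z * exp (ℓ z)) r₀ R₀ := by
  have hμ0 : μ ≠ 0 := norm_ne_zero_iff.1 (by rw [hμ]; exact one_ne_zero)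
  have hℓ1 : ∀ z, ‖z‖ = 1 → AnalyticAt ℂ ℓ z := fun z hz => hℓ z (by linarith) (by linarith)
  have hz0 : ∀ z : ℂ, ‖z‖ = 1 → z ≠ 0 := fun z hz =>
    norm_ne_zero_iff.1 (by rw [hz]; exact one_ne_zero)
  have hder : ∀ z, ‖z‖ = 1 → HasDerivAt (fun z => μ * z * exp (ℓ z))
      (μ * exp (ℓ z) * (1 + z * deriv ℓ z)) z := by
    intro z hz
    have := ((hasDerivAt_id z).const_mul μ).mul (hℓ1 z hz).differentiableAt.hasDerivAt.cexp
    refine this.congr_deriv ?_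
    simp only [id]
    ring
  have hre : ∀ z, ‖z‖ = 1 → (ℓ z).re = 0 := by
    intro z hz
    have := heq z hz
    rw [norm_mul, norm_mul, hμ, hz, norm_exp, one_mul, one_mul] at this
    exact Real.exp_eq_one_iff _ |>.1 this
  have hne : ∀ z, ‖z‖ = 1 → 1 + z * deriv ℓ z ≠ 0 := by
    intro z hz h
    have := hpos z hz
    rw [h] at this
    exact lt_irrefl _ this
  set ψ : ℝ → ℝ := fun θ => θ + (ℓ (exp (θ * I))).im with hψ
  have hunit : ∀ θ : ℝ, ‖exp (θ * I)‖ = 1 := norm_exp_ofReal_mul_I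
  have hψder : ∀ θ : ℝ, HasDerivAt ψ (1 + exp (θ * I) * deriv ℓ (exp (θ * I))).re θ := by
    intro θ
    have hin : HasDerivAt (fun t : ℝ => exp (t * I)) (exp (θ * I) * I) θ := by
      have := ((ofRealCLM.hasDerivAt (x := θ)).mul_const I).cexp
      simpa using this
    have hout := (hℓ1 _ (hunit θ)).differentiableAt.hasDerivAt.comp θ hin
    have him := imCLM.hasFDerivAt.comp_hasDerivAt θ hout
    refine ((hasDerivAt_id θ).add him).congr_deriv ?_
    simp [add_re, mul_re, mul_im]
    ring
  have hmono : StrictMono ψ := strictMono_of_deriv_pos fun θ => by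
    rw [(hψder θ).deriv]
    exact hpos _ (hunit θ)
  have hval : ∀ θ : ℝ, μ * exp (θ * I) * exp (ℓ (exp (θ * I))) = μ * exp (ψ θ * I) := by
    intro θ
    have : ℓ (exp (θ * I)) = (ℓ (exp (θ * I))).im * I := by
      conv_lhs => rw [← re_add_im (ℓ (exp (θ * I))), hre _ (hunit θ)]
      simp
    rw [mul_assoc, ← exp_add]
    congr 2
    conv_lhs => rw [this]
    rw [hψ]
    push_cast
    ring
  have harg : ∀ z : ℂ, ‖z‖ = 1 → exp (arg z * I) = z := fun z hz => by
    have := norm_mul_exp_arg_mul_I z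
    rwa [hz, ofReal_one, one_mul] at this
  have hsurj : Function.Surjective ψ := by
    have hcont : Continuous ψ :=
      continuous_iff_continuousAt.2 fun θ => (hψder θ).continuousAt
    obtain ⟨C, hC⟩ := (isCompact_sphere (0 : ℂ) 1).exists_bound_of_continuousOn
      (f := ℓ) fun z hz => (hℓ1 z (by simpa using hz)).continuousAt.continuousWithinAt
    have hb : ∀ θ : ℝ, |(ℓ (exp (θ * I))).im| ≤ C := fun θ =>
      (abs_im_le_norm _).trans (hC _ (by simp [hunit θ]))
    exact hcont.surjective
      (Filter.tendsto_atTop_add_right_of_le _ (-C) Filter.tendsto_id fun θ => (abs_le.1 (hb θ)).1)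
      (Filter.tendsto_atBot_add_right_of_ge _ C Filter.tendsto_id fun θ => (abs_le.1 (hb θ)).2)
  refine ⟨h0, h1, h2, fun z hr hR => ?_, fun z hr hR => ?_, hlt, heq, hgt, ?_, ?_, ?_, ?_⟩
  · exact (analyticAt_const.mul analyticAt_id).mul (hℓ z hr hR).cexp
  · exact mul_ne_zero (mul_ne_zero hμ0 (norm_pos_iff.1 (h0.trans hr))) (exp_ne_zero _)
  · intro z hz w hw hzw
    have hz : ‖z‖ = 1 := by simpa using hz
    have hw : ‖w‖ = 1 := by simpa using hw
    rw [← harg z hz, ← harg w hw] at hzw ⊢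
    simp only [hval] at hzw
    obtain ⟨m, hm⟩ := exp_eq_exp_iff_exists_int.1 (mul_left_cancel₀ hμ0 hzw)
    have hm' : ψ (arg z) = ψ (arg w) + m * (2 * Real.pi) := by
      have : ((ψ (arg z) : ℝ) : ℂ) = ψ (arg w) + m * (2 * Real.pi) :=
        mul_right_cancel₀ I_ne_zero (by linear_combination hm)
      exact_mod_cast this
    have hper : exp (((arg w + m * (2 * Real.pi) : ℝ) : ℂ) * I) = exp (arg w * I) :=
      exp_eq_exp_iff_exists_int.2 ⟨m, by push_cast; ring⟩
    have hshift : ψ (arg w + m * (2 * Real.pi)) = ψ (arg w) + m * (2 * Real.pi) := by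
      simp only [hψ, hper]
      ring
    rw [hmono.injective (hm'.trans hshift.symm), hper]
  · intro w hw
    have hw : ‖w‖ = 1 := by simpa using hw
    obtain ⟨θ, hθ⟩ := hsurj (arg (w / μ))
    refine ⟨exp (θ * I), by simp [hunit θ], ?_⟩
    simp only [hval, hθ]
    rw [harg _ (by rw [norm_div, hw, hμ, div_one]), mul_div_cancel₀ _ hμ0]
  · intro z hz
    rw [(hder z hz).deriv]
    exact mul_ne_zero (mul_ne_zero hμ0 (exp_ne_zero _)) (hne z hz)
  · have hcongr : (∮ z in C(0, 1), deriv (fun z => μ * z * exp (ℓ z)) z / (μ * z * exp (ℓ z)))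
        = ∮ z in C(0, 1), ((z - 0)⁻¹ + deriv ℓ z) := by
      refine circleIntegral.integral_congr zero_le_one fun z hz => ?_
      have hz : ‖z‖ = 1 := by simpa using hz
      have := hz0 z hz
      have := exp_ne_zero (ℓ z)
      simp only [(hder z hz).deriv, sub_zero]
      field_simp
    rw [hcongr, circleIntegral.integral_add, circleIntegral.integral_sub_center_inv 0 one_ne_zero,
      circleIntegral.integral_eq_zero_of_hasDerivWithinAt zero_le_one fun z hz =>
        (hℓ1 z (by simpa using hz)).differentiableAt.hasDerivAt.hasDerivWithinAt, add_zero]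
    · refine ContinuousOn.circleIntegrable zero_le_one fun z hz => ?_
      have hz : ‖z‖ = 1 := by simpa using hz
      exact (continuousAt_id.sub continuousAt_const).inv₀ (by simpa using hz0 z hz)
        |>.continuousWithinAt
    · exact ContinuousOn.circleIntegrable zero_le_one fun z hz =>
        (hℓ1 z (by simpa using hz)).deriv.continuousAt.continuousWithinAt

lemma normSq_one_sub_conj_mul (a z : ℂ) :
    normSq (1 - (starRingEnd ℂ) a * z) =
      normSq (z - a) + (1 - normSq a) * (1 - normSq z) := by
  simp only [normSq_apply, sub_re, sub_im, mul_re, mul_im, conj_re, conj_im, one_re, one_im]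
  ring

lemma one_sub_conj_mul_ne_zero {a z : ℂ} (h : ‖a‖ * ‖z‖ < 1) :
    1 - (starRingEnd ℂ) a * z ≠ 0 := by
  intro h0
  have := congrArg norm (sub_eq_zero.1 h0)
  rw [norm_mul, norm_conj, norm_one] at this
  linarith

lemma normSq_lt_one {a : ℂ} (ha : ‖a‖ < 1) : normSq a < 1 := by
  rw [normSq_eq_norm_sq]
  exact pow_lt_one₀ (norm_nonneg a) ha two_ne_zero

lemma norm_sub_lt_norm_one_sub {a z : ℂ} (ha : ‖a‖ < 1) (hz : ‖z‖ < 1) :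
    ‖z - a‖ < ‖1 - (starRingEnd ℂ) a * z‖ := by
  rw [← sq_lt_sq₀ (norm_nonneg _) (norm_nonneg _), ← normSq_eq_norm_sq, ← normSq_eq_norm_sq,
    normSq_one_sub_conj_mul]
  nlinarith [normSq_lt_one ha, normSq_lt_one hz]

lemma norm_sub_eq_norm_one_sub {a z : ℂ} (hz : ‖z‖ = 1) :
    ‖z - a‖ = ‖1 - (starRingEnd ℂ) a * z‖ := by
  rw [← sq_eq_sq₀ (norm_nonneg _) (norm_nonneg _), ← normSq_eq_norm_sq, ← normSq_eq_norm_sq,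
    normSq_one_sub_conj_mul, normSq_eq_norm_sq z, hz]
  ring

lemma norm_one_sub_lt_norm_sub {a z : ℂ} (ha : ‖a‖ < 1) (hz : 1 < ‖z‖) :
    ‖1 - (starRingEnd ℂ) a * z‖ < ‖z - a‖ := by
  rw [← sq_lt_sq₀ (norm_nonneg _) (norm_nonneg _), ← normSq_eq_norm_sq, ← normSq_eq_norm_sq,
    normSq_one_sub_conj_mul]
  have : 1 < normSq z := by
    rw [normSq_eq_norm_sq]
    exact one_lt_pow₀ hz two_ne_zero
  nlinarith [normSq_lt_one ha]

/-- The finite Blaschke product with unimodular factor `c` and zeros `a`. -/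
noncomputable def blaschke {n : ℕ} (c : ℂ) (a : Fin n → ℂ) (z : ℂ) : ℂ :=
  c * ∏ k, (z - a k) / (1 - (starRingEnd ℂ) (a k) * z)

section Blaschke

variable {n : ℕ} {c : ℂ} {a : Fin n → ℂ} {z : ℂ}

lemma norm_blaschke (hc : ‖c‖ = 1) :
    ‖blaschke c a z‖ = ∏ k, ‖z - a k‖ / ‖1 - (starRingEnd ℂ) (a k) * z‖ := by
  simp only [blaschke, norm_mul, hc, one_mul, norm_prod, norm_div]

lemma norm_blaschke_eq_one (hc : ‖c‖ = 1) (ha : ∀ k, ‖a k‖ < 1) (hz : ‖z‖ = 1) :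
    ‖blaschke c a z‖ = 1 := by
  rw [norm_blaschke hc]
  refine Finset.prod_eq_one fun k _ => ?_
  rw [norm_sub_eq_norm_one_sub hz]
  exact div_self (norm_ne_zero_iff.2 (one_sub_conj_mul_ne_zero (by rw [hz, mul_one]; exact ha k)))

lemma norm_blaschke_lt_one (hn : 0 < n) (hc : ‖c‖ = 1) (ha : ∀ k, ‖a k‖ < 1) (hz : ‖z‖ < 1) :
    ‖blaschke c a z‖ < 1 := by
  rw [norm_blaschke hc]
  have hlt : ∀ k, ‖z - a k‖ / ‖1 - (starRingEnd ℂ) (a k) * z‖ < 1 := fun k =>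
    (div_lt_one ((norm_nonneg _).trans_lt (norm_sub_lt_norm_one_sub (ha k) hz))).2
      (norm_sub_lt_norm_one_sub (ha k) hz)
  rw [← Finset.mul_prod_erase _ _ (Finset.mem_univ (⟨0, hn⟩ : Fin n))]
  exact mul_lt_one_of_nonneg_of_lt_one_left (by positivity) (hlt _)
    (Finset.prod_le_one (fun k _ => by positivity) fun k _ => (hlt k).le)

lemma one_lt_norm_blaschke (hn : 0 < n) (hc : ‖c‖ = 1) (ha : ∀ k, ‖a k‖ < 1) (hz : 1 < ‖z‖)
    (haz : ∀ k, ‖a k‖ * ‖z‖ < 1) : 1 < ‖blaschke c a z‖ := by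
  rw [norm_blaschke hc, ← Finset.prod_const_one (s := (Finset.univ : Finset (Fin n)))]
  refine Finset.prod_lt_prod_of_nonempty (fun _ _ => one_pos) (fun k _ => ?_)
    ⟨⟨0, hn⟩, Finset.mem_univ _⟩
  exact (one_lt_div (norm_pos_iff.2 (one_sub_conj_mul_ne_zero (haz k)))).2
    (norm_one_sub_lt_norm_sub (ha k) hz)

lemma analyticOnNhd_blaschke (ha : ∀ k, ‖a k‖ < 1) :
    AnalyticOnNhd ℂ (blaschke c a) (closedBall 0 1) := by
  intro z hz
  have hz : ‖z‖ ≤ 1 := by simpa using hz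
  refine analyticAt_const.mul (Finset.analyticAt_fun_prod _ fun k _ => ?_)
  exact (analyticAt_id.sub analyticAt_const).div
    (analyticAt_const.sub (analyticAt_const.mul analyticAt_id))
    (one_sub_conj_mul_ne_zero
      ((mul_le_of_le_one_right (norm_nonneg _) hz).trans_lt (ha k)))

lemma exists_finset_blaschke_fibre (hn : 0 < n) (hc : ‖c‖ = 1) (ha : ∀ k, ‖a k‖ < 1) (ζ : ℂ) :
    ∃ Z : Finset ℂ, Z.card ≤ n ∧ ∀ z, ‖z‖ < 1 → blaschke c a z = ζ → z ∈ Z := by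
  rcases le_or_gt 1 ‖ζ‖ with hζ | hζ
  · refine ⟨∅, by simp, fun z hz hB => ?_⟩
    have := norm_blaschke_lt_one hn hc ha hz
    rw [hB] at this
    linarith
  set Q : ℂ[X] := C c * ∏ k, (X - C (a k)) - C ζ * ∏ k, (1 - C ((starRingEnd ℂ) (a k)) * X) with hQ
  have hlin : ∀ f : Fin n → ℂ[X], (∀ k, (f k).natDegree ≤ 1) → (∏ k, f k).natDegree ≤ n :=
    fun f hf => (natDegree_prod_le _ _).trans
      ((Finset.sum_le_sum fun k _ => hf k).trans (by simp))
  have hdeg : Q.natDegree ≤ n := by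
    refine (natDegree_sub_le _ _).trans (max_le ?_ ?_)
    · exact (natDegree_C_mul_le _ _).trans (hlin _ fun k => by compute_degree)
    · exact (natDegree_C_mul_le _ _).trans (hlin _ fun k => by compute_degree)
  have heval : ∀ z, (∀ k, ‖a k‖ * ‖z‖ < 1) →
      Q.eval z = (blaschke c a z - ζ) * ∏ k, (1 - (starRingEnd ℂ) (a k) * z) := by
    intro z hz
    have hprod : (∏ k, (1 - (starRingEnd ℂ) (a k) * z)) ≠ 0 :=
      Finset.prod_ne_zero_iff.2 fun k _ => one_sub_conj_mul_ne_zero (hz k)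
    rw [hQ, blaschke, Finset.prod_div_distrib]
    simp only [eval_sub, eval_mul, eval_C, eval_prod, eval_X, eval_one]
    rw [sub_mul, ← mul_div_assoc, div_mul_cancel₀ _ hprod]
  have hQ0 : Q ≠ 0 := by
    intro h0
    have h1 : ∀ k, ‖a k‖ * ‖(1 : ℂ)‖ < 1 := fun k => by rw [norm_one, mul_one]; exact ha k
    have := heval 1 h1
    rw [h0, eval_zero, eq_comm, mul_eq_zero, sub_eq_zero] at this
    refine this.elim (fun h => ?_)
      (Finset.prod_ne_zero_iff.2 fun k _ => one_sub_conj_mul_ne_zero (h1 k))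
    have h2 := norm_blaschke_eq_one (z := 1) hc ha norm_one
    rw [h] at h2
    linarith
  refine ⟨Q.roots.toFinset, (Multiset.toFinset_card_le _).trans ((card_roots' Q).trans hdeg),
    fun z hz hB => ?_⟩
  rw [Multiset.mem_toFinset, mem_roots hQ0, IsRoot.def, heval z fun k =>
    (mul_le_of_le_one_right (norm_nonneg _) hz.le).trans_lt (ha k), hB, sub_self, zero_mul]

/-- The logarithm of the ratio between the `n`-th root of a Blaschke product and the identity,
up to a unimodular constant. -/
noncomputable def blaschkeLog (a : Fin n → ℂ) (z : ℂ) : ℂ :=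
  (n : ℂ)⁻¹ * ∑ k, (log (1 - a k / z) - log (1 - (starRingEnd ℂ) (a k) * z))

lemma one_sub_mem_slitPlane {u : ℂ} (hu : ‖u‖ < 1) : 1 - u ∈ slitPlane := by
  rw [sub_eq_add_neg]
  exact mem_slitPlane_of_norm_lt_one (by rwa [norm_neg])

lemma norm_div_lt_one {a z : ℂ} (h : ‖a‖ < ‖z‖) : ‖a / z‖ < 1 := by
  rw [norm_div]
  exact (div_lt_one ((norm_nonneg a).trans_lt h)).2 h

lemma analyticAt_blaschkeLog (haz : ∀ k, ‖a k‖ < ‖z‖) (haz' : ∀ k, ‖a k‖ * ‖z‖ < 1) (hz : z ≠ 0) :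
    AnalyticAt ℂ (blaschkeLog a) z := by
  refine analyticAt_const.mul (Finset.analyticAt_fun_sum _ fun k _ => ?_)
  refine ((analyticAt_const.sub (analyticAt_const.div analyticAt_id hz)).clog ?_).sub
    ((analyticAt_const.sub (analyticAt_const.mul analyticAt_id)).clog ?_)
  · exact one_sub_mem_slitPlane (norm_div_lt_one (haz k))
  · exact one_sub_mem_slitPlane (by simpa using haz' k)

lemma pow_exp_blaschkeLog {μ : ℂ} (hn : n ≠ 0) (hμ : μ ^ n = c) (haz : ∀ k, ‖a k‖ < ‖z‖)
    (haz' : ∀ k, ‖a k‖ * ‖z‖ < 1) (hz : z ≠ 0) :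
    (μ * z * exp (blaschkeLog a z)) ^ n = blaschke c a z := by
  have hn' : (n : ℂ) ≠ 0 := Nat.cast_ne_zero.2 hn
  rw [mul_pow, mul_pow, hμ, ← exp_nat_mul, blaschkeLog, mul_inv_cancel_left₀ hn', exp_sum, blaschke,
    mul_assoc]
  congr 1
  rw [← Fin.prod_const, ← Finset.prod_mul_distrib]
  refine Finset.prod_congr rfl fun k _ => ?_
  rw [exp_sub, exp_log (slitPlane_ne_zero (one_sub_mem_slitPlane (norm_div_lt_one (haz k)))),
    exp_log (one_sub_conj_mul_ne_zero (haz' k))]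
  field_simp

lemma one_add_mul_deriv_blaschkeLog_re_pos (hn : 0 < n) (ha : ∀ k, ‖a k‖ < 1) (hz : ‖z‖ = 1) :
    0 < (1 + z * deriv (blaschkeLog a) z).re := by
  have hz0 : z ≠ 0 := norm_ne_zero_iff.1 (by rw [hz]; exact one_ne_zero)
  have hn' : (n : ℂ) ≠ 0 := Nat.cast_ne_zero.2 hn.ne'
  have hne : ∀ k, 1 - (starRingEnd ℂ) (a k) * z ≠ 0 := fun k =>
    one_sub_conj_mul_ne_zero (by rw [hz, mul_one]; exact ha k)
  have hlt : ∀ k, ‖a k / z‖ < 1 := fun k => norm_div_lt_one (by rw [hz]; exact ha k)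
  have hne' : ∀ k, 1 - a k / z ≠ 0 := fun k => slitPlane_ne_zero (one_sub_mem_slitPlane (hlt k))
  have hder : HasDerivAt (blaschkeLog a) ((n : ℂ)⁻¹ * ∑ k, (a k / z ^ 2 / (1 - a k / z)
      + (starRingEnd ℂ) (a k) / (1 - (starRingEnd ℂ) (a k) * z))) z := by
    refine (HasDerivAt.fun_sum fun k _ => ?_).const_mul _
    have h1 : HasDerivAt (fun z => 1 - a k / z) (a k / z ^ 2) z := by
      have := ((hasDerivAt_inv hz0).const_mul (a k)).const_sub 1
      refine this.congr_deriv ?_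
      field_simp
    have h2 : HasDerivAt (fun z => 1 - (starRingEnd ℂ) (a k) * z) (-(starRingEnd ℂ) (a k)) z := by
      simpa using ((hasDerivAt_id z).const_mul ((starRingEnd ℂ) (a k))).const_sub 1
    refine ((h1.clog (one_sub_mem_slitPlane (hlt k))).sub
      (h2.clog (one_sub_mem_slitPlane (by simpa [hz] using ha k)))).congr_deriv ?_
    rw [neg_div, sub_neg_eq_add]
  have hconj : (starRingEnd ℂ) z = z⁻¹ := by
    rw [inv_def, normSq_eq_norm_sq, hz]
    simp
  have hsum : 1 + z * deriv (blaschkeLog a) z =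
      (((n : ℝ)⁻¹ * ∑ k, (1 - normSq (a k)) / normSq (1 - (starRingEnd ℂ) (a k) * z) : ℝ) : ℂ) := by
    have hone : (n : ℂ)⁻¹ * ∑ _k : Fin n, (1 : ℂ) = 1 := by simp [hn']
    have hterm : ∀ k, 1 + z * (a k / z ^ 2 / (1 - a k / z)
        + (starRingEnd ℂ) (a k) / (1 - (starRingEnd ℂ) (a k) * z)) =
        (1 - normSq (a k)) / normSq (1 - (starRingEnd ℂ) (a k) * z) := by
      intro k
      rw [← mul_conj (a k), ← mul_conj (1 - (starRingEnd ℂ) (a k) * z)]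
      simp only [map_sub, map_mul, map_one, conj_conj, hconj, ← div_eq_mul_inv]
      have h1 := hne k
      have h2 := hne' k
      rw [show a k / z ^ 2 / (1 - a k / z) = a k / z / (1 - a k / z) / z by ring]
      have h3 : a k = a k / z * z := (div_mul_cancel₀ _ hz0).symm
      generalize a k / z = v at h2 h3 ⊢
      generalize (starRingEnd ℂ) (a k) = b at h1 ⊢
      rw [h3]
      rw [mul_comm b z] at h1 ⊢
      field_simp
      ring
    rw [hder.deriv]
    push_cast
    rw [← Finset.sum_congr rfl fun k _ => hterm k]
    rw [Finset.sum_add_distrib (f := fun _ => (1 : ℂ)), mul_add, hone, ← Finset.mul_sum,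
      mul_left_comm]
  rw [hsum, ofReal_re]
  refine mul_pos (inv_pos.2 (Nat.cast_pos.2 hn)) (Finset.sum_pos (fun k _ => ?_)
    ⟨⟨0, hn⟩, Finset.mem_univ _⟩)
  exact div_pos (sub_pos.2 (normSq_lt_one (ha k))) (normSq_pos.2 (hne k))

theorem exists_weldingMap_pow_eq_blaschke (hn : 0 < n) (hc : ‖c‖ = 1) (ha : ∀ k, ‖a k‖ < 1) :
    ∃ (k : ℂ → ℂ) (r₀ R₀ : ℝ), WeldingMap k r₀ R₀ ∧
      ∀ z, ‖z‖ = 1 → k z ^ n = blaschke c a z := by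
  obtain ⟨r, har, hr⟩ : ∃ r : ℝ, (∀ k, ‖a k‖ < r) ∧ 0 < r ∧ r < 1 := by
    have h1 : ∀ᶠ r : ℝ in nhdsWithin 1 (Iio 1), ∀ k, ‖a k‖ < r :=
      Filter.eventually_all.2 fun k => nhdsWithin_le_nhds (lt_mem_nhds (ha k))
    exact (h1.and (Ioo_mem_nhdsLT one_pos)).exists
  obtain ⟨hr0, hr1⟩ := hr
  obtain ⟨μ, hμ⟩ := IsAlgClosed.exists_pow_nat_eq c hn
  have hμ1 : ‖μ‖ = 1 := (pow_eq_one_iff_of_nonneg (norm_nonneg μ) hn.ne').1 (by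
    rw [← norm_pow, hμ, hc])
  have hout : ∀ z : ℂ, ‖z‖ < r⁻¹ → ∀ k, ‖a k‖ * ‖z‖ < 1 := fun z hz k => by
    calc ‖a k‖ * ‖z‖ ≤ r * ‖z‖ := by gcongr; exact (har k).le
      _ < r * r⁻¹ := by gcongr
      _ = 1 := mul_inv_cancel₀ hr0.ne'
  have hin : ∀ z : ℂ, r < ‖z‖ → ∀ k, ‖a k‖ < ‖z‖ := fun z hz k => (har k).trans hz
  have hz0 : ∀ z : ℂ, r < ‖z‖ → z ≠ 0 := fun z hz => norm_pos_iff.1 (hr0.trans hz)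
  have hR : 1 < r⁻¹ := (one_lt_inv₀ hr0).2 hr1
  have hpow : ∀ z, r < ‖z‖ → ‖z‖ < r⁻¹ →
      (μ * z * exp (blaschkeLog a z)) ^ n = blaschke c a z := fun z h1 h2 =>
    pow_exp_blaschkeLog hn.ne' hμ (hin z h1) (hout z h2) (hz0 z h1)
  have hnorm : ∀ z, r < ‖z‖ → ‖z‖ < r⁻¹ →
      ‖μ * z * exp (blaschkeLog a z)‖ ^ n = ‖blaschke c a z‖ := fun z h1 h2 => by
    rw [← norm_pow, hpow z h1 h2]
  refine ⟨_, r, r⁻¹, weldingMap_of_exp hr0 hr1 hR hμ1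
    (fun z h1 h2 => analyticAt_blaschkeLog (hin z h1) (hout z h2) (hz0 z h1))
    (fun z h1 h2 => ?_) (fun z hz => ?_) (fun z h1 h2 => ?_)
    (fun z hz => one_add_mul_deriv_blaschkeLog_re_pos hn ha hz),
    fun z hz => hpow z (by linarith) (by linarith)⟩
  · rw [← pow_lt_one_iff_of_nonneg (norm_nonneg _) hn.ne', hnorm z h1 (h2.trans hR)]
    exact norm_blaschke_lt_one hn hc ha h2
  · rw [← pow_eq_one_iff_of_nonneg (norm_nonneg _) hn.ne', hnorm z (by linarith) (by linarith)]
    exact norm_blaschke_eq_one hc ha hz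
  · rw [← one_lt_pow_iff_of_nonneg (norm_nonneg _) hn.ne', hnorm z (by linarith) h2]
    exact one_lt_norm_blaschke hn hc ha h1 (hout z h2)

end Blaschke

/-- Converse direction of the Ebenfelt–Khavinson–Shapiro theorem:
given a finite Blaschke product `B` of degree `n`, there exists a polynomial `P`
of degree `n` with positive leading coefficient whose lemniscate `L_P(1)` is an
analytic connected Jordan curve with fingerprint `k` satisfying `k(z)^n = B(z)`. -/
theorem eks_converse (n : ℕ) (hn : 1 ≤ n)
    (a : Fin n → ℂ) (ha : ∀ k, ‖a k‖ < 1) (lam : ℂ) (hlam : ‖lam‖ = 1)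
    (B : ℂ → ℂ)
    (hB : B = fun z => lam * ∏ k, (z - a k) / (1 - (starRingEnd ℂ) (a k) * z)) :
    ∃ (P : ℂ[X]) (φm φp : ℂ → ℂ),
      P.natDegree = n ∧ (∃ c : ℝ, 0 < c ∧ P.leadingCoeff = (c : ℂ)) ∧
      ConformalPair {z : ℂ | ‖P.eval z‖ = 1} φm φp ∧
      (∀ z : ℂ, ‖P.eval z‖ = 1 → P.derivative.eval z ≠ 0) ∧
      (∀ z w : ℂ, ‖z‖ = 1 → ‖w‖ = 1 → φp w = φm z → w ^ n = B z) := by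
  obtain ⟨k, r₀, R₀, hk, hkB⟩ := exists_weldingMap_pow_eq_blaschke hn hlam ha
  obtain ⟨φ, G, hφ, hG, hφG⟩ := hk.exists_welding
  obtain ⟨P, hdeg, hmonic, hevalB, hevalpow⟩ := hk.exists_polynomial hφ hG
    (analyticOnNhd_blaschke ha) hφG (Nat.ne_of_gt hn) hkB
  have h : LemniscateData k φ G (blaschke lam a) r₀ R₀ n P :=
    { welding := hk
      analytic_int := hφ
      analytic_ext := hG
      matching := hφG
      natDegree_pos := hn
      natDegree_eq := hdeg
      eval_int := hevalB
      eval_ext := hevalpow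
      norm_lt := fun z hz => norm_blaschke_lt_one hn hlam ha hz
      norm_eq := fun z hz => norm_blaschke_eq_one hlam ha hz
      fibre := exists_finset_blaschke_fibre hn hlam ha }
  refine ⟨P, φ, fun w => w + G w⁻¹, hdeg, ⟨1, one_pos, by rw [hmonic.leadingCoeff, ofReal_one]⟩,
    h.conformalPair, fun z hz => h.derivative_ne_zero hz.ge, fun z w hz hw hzw => ?_⟩
  rw [hB, ← hevalpow w hw.ge]
  exact (congrArg P.eval hzw).trans (hevalB z hz.le)
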